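/- For the acceptance modes (σ,ρ) ∈ {(inf,⊓), (inf,=)}, the family of ω-languages (σ,ρ,nl)-accepted by context-free ω-grammars is strictly included in the family of ω-languages (σ,ρ,l)-accepted by context-free ω-grammars: 𝓛_{σ,ρ,nl}(ω-CFG) ⊊ 𝓛_{σ,ρ,l}(ω-CFG). In particular, the ω-language L = {aⁿbⁿ | n ≥ 1}^ω belongs to 𝓛_{σ,ρ,l}(ω-CFG) but not to 𝓛_{σ,ρ,nl}(ω-CFG) for these modes. -/

import Mathlib

namespace OmegaFormal

/-- σ component of an acceptance mode: `ran` (occurs at least once)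
or `inf` (occurs infinitely often). -/
inductive AccSigma | ran | inf
deriving DecidableEq

/-- ρ component of an acceptance mode: `cap` (nonempty intersection, ⊓),
`sub` (⊆) or `eq` (=). -/
inductive AccRho | cap | sub | eq
deriving DecidableEq

/-- derivation mode: leftmost (`l`) or normal (`nl`). -/
inductive DerivMode | l | nl
deriving DecidableEq

/-- `sigmaSet σ f` is ran(f) resp. inf(f). -/
def sigmaSet {Q : Type _} : AccSigma → (ℕ → Q) → Set Q
  | .ran, f => Set.range f
  | .inf, f => {q | ∀ n : ℕ, ∃ m : ℕ, n ≤ m ∧ f m = q}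

/-- the binary relation denoted by ρ. -/
def rhoRel {Q : Type _} : AccRho → Set Q → Set Q → Prop
  | .cap, A, B => (A ∩ B).Nonempty
  | .sub, A, B => A ⊆ B
  | .eq,  A, B => A = B

/-- f is (σ,ρ)-accepting w.r.t. the set 𝓕 of designated sets. -/
def IsAccepting {Q : Type _} (σ : AccSigma) (ρ : AccRho) (𝓕 : Set (Set Q)) (f : ℕ → Q) : Prop :=
  ∃ F ∈ 𝓕, rhoRel ρ (sigmaSet σ f) F

/-- the finite word `l` coincides with the prefix of the ω-word `u`. -/
def MatchesPrefix {T : Type _} (l : List T) (u : ℕ → T) : Prop :=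
  ∀ (k : ℕ) (h : k < l.length), l.get ⟨k, h⟩ = u k

/-- the maximal terminal prefix of a sentential form. -/
def termPrefix {N T : Type _} : List (N ⊕ T) → List T
  | [] => []
  | (Sum.inl _) :: _ => []
  | (Sum.inr a) :: l => a :: termPrefix l

/-- A phrase structure ω-grammar `G = (N, T, P, S, 𝓕)`:
`N` nonterminals, `T` terminals, `P` named productions `p : lhs p → rhs p`
with `lhs p ∈ N⁺`, `rhs p ∈ (N ∪ T)*`, start symbol, and
production repetition sets `acc ⊆ 2^P`. -/
structure OmegaPSG (T : Type) where
  N : Type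
  [fintypeN : Fintype N]
  P : Type
  [fintypeP : Fintype P]
  lhs : P → List N
  lhs_ne : ∀ p : P, lhs p ≠ []
  rhs : P → List (N ⊕ T)
  start : N
  acc : Set (Set P)

namespace OmegaPSG

variable {T : Type} (G : OmegaPSG T)

/-- one (normal) rewriting step using production p. -/
def Step (p : G.P) (x y : List (G.N ⊕ T)) : Prop :=
  ∃ u v : List (G.N ⊕ T),
    x = u ++ (G.lhs p).map Sum.inl ++ v ∧ y = u ++ G.rhs p ++ v

/-- one leftmost rewriting step: the rewritten occurrence starts at the
leftmost nonterminal, i.e. everything to its left is terminal. -/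
def LStep (p : G.P) (x y : List (G.N ⊕ T)) : Prop :=
  ∃ u v : List (G.N ⊕ T), (∀ s ∈ u, ∃ a : T, s = Sum.inr a) ∧
    x = u ++ (G.lhs p).map Sum.inl ++ v ∧ y = u ++ G.rhs p ++ v

def StepOf : DerivMode → G.P → List (G.N ⊕ T) → List (G.N ⊕ T) → Prop
  | .l => G.LStep
  | .nl => G.Step

/-- `L_{σ,ρ,π}(G)`: ω-words admitting an infinite π-derivation from S whose
growing terminal prefixes spell the word and whose production sequence is
(σ,ρ)-accepting w.r.t. `G.acc`. -/
def Lang (σ : AccSigma) (ρ : AccRho) (π : DerivMode) : Set (ℕ → T) :=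
  {u | ∃ (s : ℕ → List (G.N ⊕ T)) (d : ℕ → G.P),
    s 0 = [Sum.inl G.start] ∧
    (∀ i : ℕ, G.StepOf π (d i) (s i) (s (i + 1))) ∧
    (∀ n : ℕ, ∃ i : ℕ, n ≤ (termPrefix (s i)).length) ∧
    (∀ i : ℕ, MatchesPrefix (termPrefix (s i)) u) ∧
    IsAccepting σ ρ G.acc d}

/-- context-free: every left-hand side is a single nonterminal. -/
def IsCFG : Prop := ∀ p : G.P, (G.lhs p).length = 1

/-- context-sensitive (monotonic): `|β| ≥ |α|` for every production. -/
def IsCSG : Prop := ∀ p : G.P, (G.lhs p).length ≤ (G.rhs p).length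

/-- right linear: productions of the form `A → uB` or `A → u`, `u ∈ T*`. -/
def IsRLG : Prop :=
  ∀ p : G.P, (G.lhs p).length = 1 ∧
    ∃ (w : List T) (B : Option G.N),
      G.rhs p = w.map Sum.inr ++ B.toList.map Sum.inl

/-- `G` is a grammar with `$`-boundary (PSG version): with `$` = `dollar`,
`S` = `S'`, every production has one of the forms
(1) α → β, α,β ∈ N⁺ (N = nonterminals other than `$`, `S`),
(2) S → $α, α ∈ N⁺, (3) $A → a$, (4) A → ε. -/
def HasDollarBoundary (dollar S' : G.N) : Prop :=
  dollar ≠ S' ∧ G.start = S' ∧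
  ∀ p : G.P,
    ((dollar ∉ G.lhs p ∧ S' ∉ G.lhs p) ∧
      ∃ β : List G.N, β ≠ [] ∧ dollar ∉ β ∧ S' ∉ β ∧ G.rhs p = β.map Sum.inl) ∨
    (G.lhs p = [S'] ∧ ∃ α : List G.N, α ≠ [] ∧ dollar ∉ α ∧ S' ∉ α ∧
      G.rhs p = Sum.inl dollar :: α.map Sum.inl) ∨
    (∃ A : G.N, A ≠ dollar ∧ A ≠ S' ∧ G.lhs p = [dollar, A] ∧
      ∃ a : T, G.rhs p = [Sum.inr a, Sum.inl dollar]) ∨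
    (∃ A : G.N, A ≠ dollar ∧ A ≠ S' ∧ G.lhs p = [A] ∧ G.rhs p = [])

/-- `G` is a grammar with `$`-boundary (CSG version): forms (1)-(3) only,
with `|α| ≤ |β|` in form (1). -/
def HasDollarBoundaryCSG (dollar S' : G.N) : Prop :=
  dollar ≠ S' ∧ G.start = S' ∧
  ∀ p : G.P,
    ((dollar ∉ G.lhs p ∧ S' ∉ G.lhs p) ∧
      ∃ β : List G.N, β ≠ [] ∧ dollar ∉ β ∧ S' ∉ β ∧ (G.lhs p).length ≤ β.length ∧
        G.rhs p = β.map Sum.inl) ∨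
    (G.lhs p = [S'] ∧ ∃ α : List G.N, α ≠ [] ∧ dollar ∉ α ∧ S' ∉ α ∧
      G.rhs p = Sum.inl dollar :: α.map Sum.inl) ∨
    (∃ A : G.N, A ≠ dollar ∧ A ≠ S' ∧ G.lhs p = [dollar, A] ∧
      ∃ a : T, G.rhs p = [Sum.inr a, Sum.inl dollar])

end OmegaPSG

/-- `𝓛_{σ,ρ,π}(X)` for the family `X` of ω-grammars over `T` satisfying `C`. -/
def GLang (T : Type) (C : OmegaPSG T → Prop) (σ : AccSigma) (ρ : AccRho) (π : DerivMode) :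
    Set (Set (ℕ → T)) :=
  {L | ∃ G : OmegaPSG T, C G ∧ L = G.Lang σ ρ π}

/-- number of non-ε labels among `b 0, …, b (i-1)`. -/
def someCount {A : Type _} (b : ℕ → Option A) (i : ℕ) : ℕ :=
  ((Finset.range i).filter fun j => (b j).isSome = true).card

/-- the (ε-allowing) label sequence `b` concatenates to the ω-word `u`. -/
def Spells {A : Type _} (b : ℕ → Option A) (u : ℕ → A) : Prop :=
  (∀ n : ℕ, ∃ i : ℕ, n ≤ someCount b i) ∧
  ∀ i : ℕ, ∀ a : A, b i = some a → a = u (someCount b i)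

/-- A finite state ω-automaton `(Q, Σ, δ, q₀, 𝓕)`. -/
structure OmegaFSA (Sig : Type) where
  Q : Type
  [fintypeQ : Fintype Q]
  init : Q
  trans : Q → Option Sig → Q → Prop
  acc : Set (Set Q)

/-- `L_{σ,ρ}(A)` for a finite state ω-automaton. -/
def OmegaFSA.Lang {Sig : Type} (A : OmegaFSA Sig) (σ : AccSigma) (ρ : AccRho) :
    Set (ℕ → Sig) :=
  {u | ∃ (r : ℕ → A.Q) (b : ℕ → Option Sig),
    r 0 = A.init ∧ (∀ i : ℕ, A.trans (r i) (b i) (r (i + 1))) ∧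
    Spells b u ∧ IsAccepting σ ρ A.acc r}

/-- `𝓛_{σ,ρ}(ω-FSA)`. -/
def FSALang (Sig : Type) (σ : AccSigma) (ρ : AccRho) : Set (Set (ℕ → Sig)) :=
  {L | ∃ A : OmegaFSA Sig, L = A.Lang σ ρ}

/-- A pushdown ω-automaton `(Q, Σ, Γ, δ, q₀, Z₀, 𝓕)`. -/
structure OmegaPDA (Sig : Type) where
  Q : Type
  [fintypeQ : Fintype Q]
  Γ : Type
  [fintypeΓ : Fintype Γ]
  init : Q
  Z0 : Γ
  trans : Q → Option Sig → Γ → Q → List Γ → Prop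
  acc : Set (Set Q)

/-- `L_{σ,ρ}(D)` for a pushdown ω-automaton. -/
def OmegaPDA.Lang {Sig : Type} (D : OmegaPDA Sig) (σ : AccSigma) (ρ : AccRho) :
    Set (ℕ → Sig) :=
  {u | ∃ (q : ℕ → D.Q) (st : ℕ → List D.Γ) (b : ℕ → Option Sig),
    q 0 = D.init ∧ st 0 = [D.Z0] ∧
    (∀ i : ℕ, ∃ (Z : D.Γ) (γ rest : List D.Γ),
      st i = Z :: rest ∧ D.trans (q i) (b i) Z (q (i + 1)) γ ∧ st (i + 1) = γ ++ rest) ∧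
    Spells b u ∧ IsAccepting σ ρ D.acc q}

/-- `𝓛_{σ,ρ}(ω-PDA)`. -/
def PDALang (Sig : Type) (σ : AccSigma) (ρ : AccRho) : Set (Set (ℕ → Sig)) :=
  {L | ∃ D : OmegaPDA Sig, L = D.Lang σ ρ}

/-- tape head moves. -/
inductive Move | L | R | S
deriving DecidableEq

def moveHead : Move → ℕ → ℕ
  | .L, n => n - 1
  | .R, n => n + 1
  | .S, n => n

/-- A single-tape Turing ω-machine `(Q, Σ, Γ, δ, q₀, 𝓕)` (Σ ⊆ Γ via `embed`). -/
structure OmegaTM (Sig : Type) where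
  Q : Type
  [fintypeQ : Fintype Q]
  Γ : Type
  [fintypeΓ : Fintype Γ]
  embed : Sig → Γ
  embed_inj : Function.Injective embed
  init : Q
  trans : Q → Γ → Q → Γ → Move → Prop
  acc : Set (Set Q)

/-- `L_{σ,ρ}(M)`: ω-words admitting a complete non-oscillating run whose state
sequence is (σ,ρ)-accepting. -/
def OmegaTM.Lang {Sig : Type} (M : OmegaTM Sig) (σ : AccSigma) (ρ : AccRho) :
    Set (ℕ → Sig) :=
  {u | ∃ (q : ℕ → M.Q) (tape : ℕ → ℕ → M.Γ) (pos : ℕ → ℕ),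
    q 0 = M.init ∧ (∀ n : ℕ, tape 0 n = M.embed (u n)) ∧ pos 0 = 0 ∧
    (∀ i : ℕ, ∃ (g : M.Γ) (m : Move),
      M.trans (q i) (tape i (pos i)) (q (i + 1)) g m ∧
      tape (i + 1) = Function.update (tape i) (pos i) g ∧
      pos (i + 1) = moveHead m (pos i)) ∧
    (∀ n : ℕ, ∃ i : ℕ, n ≤ pos i) ∧
    (∀ n : ℕ, ∃ i0 : ℕ, ∀ i : ℕ, i0 ≤ i → pos i ≠ n) ∧
    IsAccepting σ ρ M.acc q}

/-- `𝓛_{σ,ρ}(ω-TM)`. -/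
def TMLang (Sig : Type) (σ : AccSigma) (ρ : AccRho) : Set (Set (ℕ → Sig)) :=
  {L | ∃ M : OmegaTM Sig, L = M.Lang σ ρ}

/-- An m-tape Turing ω-machine. -/
structure OmegaMTM (m : ℕ) (Sig : Type) where
  Q : Type
  [fintypeQ : Fintype Q]
  Γ : Type
  [fintypeΓ : Fintype Γ]
  embed : Sig → Γ
  embed_inj : Function.Injective embed
  blank : Γ
  init : Q
  trans : Q → (Fin m → Γ) → Q → (Fin m → Γ) → (Fin m → Move) → Prop
  acc : Set (Set Q)

/-- `L_{σ,ρ}(M)` for an m-tape Turing ω-machine (`hm : 0 < m`; the input is on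
the first tape, the other tapes are initially blank; the run must be complete
and non-oscillating on the first tape). -/
def OmegaMTM.Lang {m : ℕ} {Sig : Type} (M : OmegaMTM m Sig) (hm : 0 < m)
    (σ : AccSigma) (ρ : AccRho) : Set (ℕ → Sig) :=
  {u | ∃ (q : ℕ → M.Q) (tape : ℕ → Fin m → ℕ → M.Γ) (pos : ℕ → Fin m → ℕ),
    q 0 = M.init ∧
    (∀ n : ℕ, tape 0 ⟨0, hm⟩ n = M.embed (u n)) ∧
    (∀ j : Fin m, j ≠ ⟨0, hm⟩ → ∀ n : ℕ, tape 0 j n = M.blank) ∧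
    (∀ j : Fin m, pos 0 j = 0) ∧
    (∀ i : ℕ, ∃ (g : Fin m → M.Γ) (mv : Fin m → Move),
      M.trans (q i) (fun j => tape i j (pos i j)) (q (i + 1)) g mv ∧
      (∀ j : Fin m, tape (i + 1) j = Function.update (tape i j) (pos i j) (g j)) ∧
      (∀ j : Fin m, pos (i + 1) j = moveHead (mv j) (pos i j))) ∧
    (∀ n : ℕ, ∃ i : ℕ, n ≤ pos i ⟨0, hm⟩) ∧
    (∀ n : ℕ, ∃ i0 : ℕ, ∀ i : ℕ, i0 ≤ i → pos i ⟨0, hm⟩ ≠ n) ∧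
    IsAccepting σ ρ M.acc q}

/-- `𝓛_{σ,ρ}(m-ω-TM)`. -/
def MTMLang (Sig : Type) (m : ℕ) (hm : 0 < m) (σ : AccSigma) (ρ : AccRho) :
    Set (Set (ℕ → Sig)) :=
  {L | ∃ M : OmegaMTM m Sig, L = M.Lang hm σ ρ}

/-- the ω-language `{aⁿbⁿ | n ≥ 1}^ω` over the alphabet `Bool`
(`false` = a, `true` = b). -/
def abLang : Set (ℕ → Bool) :=
  {u | ∃ n : ℕ → ℕ, (∀ i : ℕ, 1 ≤ n i) ∧
    ∀ i k : ℕ, k < 2 * n i →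
      u ((∑ j ∈ Finset.range i, 2 * n j) + k) = decide (n i ≤ k)}

end OmegaFormal

namespace OmegaFormal

/-- Dependent choice for a relation preserving an invariant. -/
theorem exists_seq {S : Type*} {Inv : ℕ → S → Prop} {Rel : ℕ → S → S → Prop} {s₀ : S}
    (h₀ : Inv 0 s₀) (hs : ∀ n s, Inv n s → ∃ s', Rel n s s' ∧ Inv (n + 1) s') :
    ∃ f : ℕ → S, f 0 = s₀ ∧ ∀ n, Inv n (f n) ∧ Rel n (f n) (f (n + 1)) := by
  have : Nonempty S := ⟨s₀⟩
  choose! g hg using hs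
  let f : ℕ → S := fun n => Nat.rec s₀ (fun k s => g k s) n
  have hI : ∀ n, Inv n (f n) := by
    intro n
    induction n with
    | zero => exact h₀
    | succ k ih => exact (hg k _ ih).2
  exact ⟨f, rfl, fun n => ⟨hI n, (hg n _ (hI n)).1⟩⟩

section Runs

variable {P X : Type*} {R : P → X → X → Prop}

/-- `Der R ps x y`: applying the labels `ps` in order leads from `x` to `y`. -/
inductive Der (R : P → X → X → Prop) : List P → X → X → Prop
  | nil (x : X) : Der R [] x x
  | cons {p : P} {ps : List P} {x y z : X} : R p x y → Der R ps y z → Der R (p :: ps) x z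

theorem Der.append {ps qs : List P} {x y z : X} (h : Der R ps x y) (h' : Der R qs y z) :
    Der R (ps ++ qs) x z := by
  induction h with
  | nil => exact h'
  | cons hs _ ih => exact .cons hs (ih h')

theorem Der.single {p : P} {x y : X} (h : R p x y) : Der R [p] x y := .cons h (.nil y)

theorem Der.eq_of_nil {x y : X} (h : Der R [] x y) : x = y := by cases h; rfl

theorem Der.map {P' X' : Type*} {R' : P' → X' → X' → Prop} (g : P → P') (f : X → X')
    (hR : ∀ p x y, R p x y → R' (g p) (f x) (f y)) {ps : List P} {x y : X}
    (h : Der R ps x y) : Der R' (ps.map g) (f x) (f y) := by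
  induction h with
  | nil => exact .nil _
  | cons hs _ ih => exact .cons (hR _ _ _ hs) ih

/-- A step with an optional label; `none` is a pause. -/
def OStep (R : P → X → X → Prop) : Option P → X → X → Prop
  | none, x, y => y = x
  | some p, x, y => R p x y

/-- An infinite derivation with pauses. -/
def IsRun (R : P → X → X → Prop) (x : ℕ → X) (o : ℕ → Option P) : Prop :=
  ∀ n, OStep R (o n) (x n) (x (n + 1))

/-- The labels occurring infinitely often in a run with pauses. -/
def infOcc (o : ℕ → Option P) : Set P := {q | ∀ n : ℕ, ∃ m : ℕ, n ≤ m ∧ o m = some q}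

theorem OStep.der {o : Option P} {x y : X} (h : OStep R o x y) : Der R o.toList x y := by
  cases o with
  | none => cases h; exact .nil _
  | some p => exact .single h

theorem IsRun.shift {x : ℕ → X} {o : ℕ → Option P} (h : IsRun R x o) (k : ℕ) :
    IsRun R (fun n => x (n + k)) (fun n => o (n + k)) := fun n => by
  have := h (n + k)
  rwa [show n + k + 1 = n + 1 + k by omega] at this

/-- The labels read between times `m` and `m + k`. -/
def labels (o : ℕ → Option P) (m k : ℕ) : List P :=
  (List.range k).flatMap fun j => (o (m + j)).toList

theorem mem_labels {o : ℕ → Option P} {m k : ℕ} {q : P} :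
    q ∈ labels o m k ↔ ∃ j, m ≤ j ∧ j < m + k ∧ o j = some q := by
  simp only [labels, List.mem_flatMap, List.mem_range, Option.mem_toList]
  constructor
  · rintro ⟨j, hj, h⟩
    exact ⟨m + j, by omega, by omega, h⟩
  · rintro ⟨j, h1, h2, h⟩
    exact ⟨j - m, by omega, by rwa [show m + (j - m) = j by omega]⟩

theorem IsRun.der {x : ℕ → X} {o : ℕ → Option P} (h : IsRun R x o) (m k : ℕ) :
    Der R (labels o m k) (x m) (x (m + k)) := by
  induction k with
  | zero => exact .nil _
  | succ k ih =>
    have : labels o m (k + 1) = labels o m k ++ (o (m + k)).toList := by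
      simp [labels, List.range_succ]
    rw [this]
    exact ih.append (h (m + k)).der

theorem infOcc_shift (o : ℕ → Option P) (k : ℕ) : infOcc (fun n => o (n + k)) = infOcc o := by
  ext q
  constructor
  · intro h n
    obtain ⟨m, hm, hq⟩ := h n
    exact ⟨m + k, by omega, hq⟩
  · intro h n
    obtain ⟨m, hm, hq⟩ := h (n + k)
    exact ⟨m - k, by omega, by simpa [show m - k + k = m by omega] using hq⟩

/-- Finitely many labels: from some time on only those in `infOcc` are read. -/
theorem exists_forall_ge_mem_infOcc [Finite P] (o : ℕ → Option P) :
    ∃ N, ∀ m, N ≤ m → ∀ q, o m = some q → q ∈ infOcc o := by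
  have := Fintype.ofFinite P
  have : ∀ q : P, ∃ N, ∀ m, N ≤ m → o m = some q → q ∈ infOcc o := by
    intro q
    by_cases hq : q ∈ infOcc o
    · exact ⟨0, fun _ _ _ => hq⟩
    · simp only [infOcc, Set.mem_ofPred_eq, not_forall, not_exists, not_and] at hq
      obtain ⟨N, hN⟩ := hq
      exact ⟨N, fun m hm h => absurd h (hN m hm)⟩
  choose N hN using this
  exact ⟨Finset.univ.sup N, fun m hm q hq =>
    hN q m ((Finset.le_sup (Finset.mem_univ q)).trans hm) hq⟩

/-- Finitely many labels: every label in `infOcc` is read in a bounded window. -/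
theorem exists_window [Finite P] (o : ℕ → Option P) (n : ℕ) :
    ∃ k, ∀ q ∈ infOcc o, q ∈ labels o n k := by
  have := Fintype.ofFinite P
  have : ∀ q : P, ∃ k, q ∈ infOcc o → q ∈ labels o n k := by
    intro q
    by_cases hq : q ∈ infOcc o
    · obtain ⟨m, hm, h⟩ := hq n
      exact ⟨m - n + 1, fun _ => mem_labels.2 ⟨m, hm, by omega, h⟩⟩
    · exact ⟨0, fun h => absurd h hq⟩
  choose k hk using this
  refine ⟨Finset.univ.sup k, fun q hq => ?_⟩
  obtain ⟨j, h1, h2, h⟩ := mem_labels.1 (hk q hq)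
  have := Finset.le_sup (f := k) (Finset.mem_univ q)
  exact mem_labels.2 ⟨j, h1, by omega, h⟩

/-- `Recurrent R Q x`: from `x` there is an endless chain of finite derivations, each using
exactly the labels in `Q`. -/
def Recurrent (R : P → X → X → Prop) (Q : Set P) (x : X) : Prop :=
  ∃ b : ℕ → X, b 0 = x ∧ ∀ i, ∃ ps : List P, {q | q ∈ ps} = Q ∧ Der R ps (b i) (b (i + 1))

theorem Recurrent.next {Q : Set P} {x : X} (h : Recurrent R Q x) :
    ∃ ps y, {q | q ∈ ps} = Q ∧ Der R ps x y ∧ Recurrent R Q y := by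
  obtain ⟨b, rfl, hb⟩ := h
  obtain ⟨ps, h1, h2⟩ := hb 0
  exact ⟨ps, b 1, h1, h2, fun i => b (i + 1), rfl, fun i => hb (i + 1)⟩

theorem Recurrent.empty (x : X) : Recurrent R ∅ x :=
  ⟨fun _ => x, rfl, fun _ => ⟨[], by simp, .nil x⟩⟩

/-- Every run can be cut into a finite part and a recurrent part. -/
theorem IsRun.exists_recurrent [Finite P] {x : ℕ → X} {o : ℕ → Option P} (h : IsRun R x o) :
    ∃ vs y, Der R vs (x 0) y ∧ Recurrent R (infOcc o) y ∧
      (∀ q ∈ vs, ∃ m, o m = some q) ∧ ∀ q m, o m = some q → q ∈ vs ∨ q ∈ infOcc o := by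
  obtain ⟨N, hN⟩ := exists_forall_ge_mem_infOcc o
  choose k hk using exists_window o
  refine ⟨labels o 0 N, x N, by simpa using h.der 0 N, ?_, ?_, ?_⟩
  · let t : ℕ → ℕ := fun n => Nat.rec N (fun _ m => m + k m) n
    have ht : ∀ n, N ≤ t n := by
      intro n
      induction n with
      | zero => exact le_rfl
      | succ n ih => exact ih.trans (Nat.le_add_right _ _)
    refine ⟨fun n => x (t n), rfl, fun i => ⟨labels o (t i) (k (t i)), ?_, h.der _ _⟩⟩
    ext q
    refine ⟨fun hq => ?_, fun hq => hk _ q hq⟩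
    obtain ⟨j, h1, -, h3⟩ := mem_labels.1 hq
    exact hN j ((ht i).trans h1) q h3
  · intro q hq
    obtain ⟨j, -, -, h3⟩ := mem_labels.1 hq
    exact ⟨j, h3⟩
  · intro q m hq
    by_cases hm : N ≤ m
    · exact Or.inr (hN m hm q hq)
    · exact Or.inl (mem_labels.2 ⟨m, by omega, by omega, hq⟩)

/-- An endless chain of finite derivations can be flattened to a run with pauses. -/
theorem exists_run_of_blocks {x : ℕ → X} {ps : ℕ → List P}
    (h : ∀ n, Der R (ps n) (x n) (x (n + 1))) :
    ∃ y o, y 0 = x 0 ∧ IsRun R y o ∧ (∀ n, ∃ m, y m = x n) ∧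
      (∀ m, ∃ n qs, Der R qs (y m) (x n)) ∧
      infOcc o = {q | ∀ n : ℕ, ∃ m, n ≤ m ∧ q ∈ ps m} := by
  obtain ⟨f, hf0, hf⟩ := exists_seq (S := ℕ × X × List P)
    (Inv := fun _ s => Der R s.2.2 s.2.1 (x (s.1 + 1)) ∧ ∀ q ∈ s.2.2, q ∈ ps s.1)
    (Rel := fun _ s s' =>
      (s.2.2 = [] ∧ s' = (s.1 + 1, s.2.1, ps (s.1 + 1))) ∨
      ∃ p, s.2.2 = p :: s'.2.2 ∧ s'.1 = s.1 ∧ R p s.2.1 s'.2.1)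
    (s₀ := (0, x 0, ps 0)) ⟨h 0, fun _ hq => hq⟩ (by
      rintro n ⟨i, y, rest⟩ ⟨hd, hr⟩
      cases rest with
      | nil =>
        refine ⟨_, Or.inl ⟨rfl, rfl⟩, ?_, fun _ hq => hq⟩
        have := hd.eq_of_nil
        simp only at this ⊢
        rw [this]
        exact h _
      | cons p rest =>
        cases hd with
        | cons hs hd =>
          exact ⟨(i, _, rest), Or.inr ⟨p, rfl, rfl, hs⟩, hd,
            fun q hq => hr q (List.mem_cons_of_mem _ hq)⟩)
  have finish : ∀ (rest : List P) (m : ℕ), (f m).2.2 = rest →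
      ∃ k, f (m + k + 1) = ((f m).1 + 1, x ((f m).1 + 1), ps ((f m).1 + 1)) ∧
        ∀ q ∈ rest, ∃ m', m ≤ m' ∧ (f m').2.2.head? = some q := by
    intro rest
    induction rest with
    | nil =>
      intro m hm
      refine ⟨0, ?_, by simp⟩
      rcases (hf m).2 with ⟨-, h2⟩ | ⟨p, h2, -⟩
      · have := (hf m).1.1
        rw [hm] at this
        rw [add_zero, h2, this.eq_of_nil]
      · rw [hm] at h2; cases h2
    | cons p rest ih =>
      intro m hm
      rcases (hf m).2 with ⟨h2, -⟩ | ⟨p', h2, h3, -⟩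
      · rw [hm] at h2; cases h2
      · have h4 : (f (m + 1)).2.2 = rest := by
          rw [hm] at h2; exact (List.cons.inj h2).2.symm
        obtain ⟨k, hk, hq⟩ := ih (m + 1) h4
        refine ⟨k + 1, ?_, ?_⟩
        · rw [show m + (k + 1) + 1 = m + 1 + k + 1 by omega, hk, h3]
        · intro q hmem
          rcases List.mem_cons.1 hmem with rfl | hmem
          · exact ⟨m, le_rfl, by rw [hm]; rfl⟩
          · obtain ⟨m', h5, h6⟩ := hq q hmem
            exact ⟨m', by omega, h6⟩
  have reach : ∀ i, ∃ m, f m = (i, x i, ps i) := by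
    intro i
    induction i with
    | zero => exact ⟨0, hf0⟩
    | succ i ih =>
      obtain ⟨m, hm⟩ := ih
      obtain ⟨k, hk, -⟩ := finish _ m rfl
      exact ⟨_, by rw [hk, hm]⟩
  have step : ∀ m, (f m).1 ≤ (f (m + 1)).1 ∧ (f (m + 1)).1 ≤ (f m).1 + 1 := by
    intro m
    rcases (hf m).2 with ⟨-, h2⟩ | ⟨p, -, h3, -⟩
    · rw [h2]; simp
    · rw [h3]; simp
  have mono : Monotone fun m => (f m).1 := monotone_nat_of_le_succ fun m => (step m).1
  have le : ∀ m, (f m).1 ≤ m := by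
    intro m
    induction m with
    | zero => rw [hf0]
    | succ m ih => exact (step m).2.trans (by omega)
  refine ⟨fun n => (f n).2.1, fun n => (f n).2.2.head?, by simp only [hf0], ?_, ?_, ?_, ?_⟩
  · intro n
    rcases (hf n).2 with ⟨h1, h2⟩ | ⟨p, h1, -, h3⟩
    · simp only [h1, h2, List.head?_nil]; rfl
    · simp only [h1, List.head?_cons]; exact h3
  · intro n
    obtain ⟨m, hm⟩ := reach n
    exact ⟨m, by simp only [hm]⟩
  · intro m
    exact ⟨_, _, (hf m).1.1⟩
  · ext q
    constructor
    · intro hq n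
      obtain ⟨m₀, h₀⟩ := reach n
      obtain ⟨m, hm, ho⟩ := hq m₀
      refine ⟨(f m).1, ?_, (hf m).1.2 q (List.mem_of_mem_head? ho)⟩
      have := mono hm
      simp only [h₀] at this
      exact this
    · intro hq n
      obtain ⟨i, hi, hmem⟩ := hq n
      obtain ⟨m, hm⟩ := reach i
      obtain ⟨k, -, hk⟩ := finish _ m rfl
      rw [hm] at hk
      obtain ⟨m', h1, h2⟩ := hk q hmem
      have := le m
      rw [hm] at this
      exact ⟨m', by simp only at this; omega, h2⟩

/-- Removing the pauses of a run in which infinitely many labels are read. -/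
theorem exists_seq_of_run {x : ℕ → X} {o : ℕ → Option P} (h : IsRun R x o)
    (hinf : ∀ n, ∃ m, n ≤ m ∧ o m ≠ none) :
    ∃ (s : ℕ → X) (d : ℕ → P), s 0 = x 0 ∧ (∀ i, R (d i) (s i) (s (i + 1))) ∧
      (∀ i, ∃ n, s i = x n) ∧ (∀ n, ∃ i, x n = s i) ∧ sigmaSet .inf d = infOcc o := by
  classical
  let next : ℕ → ℕ := fun n => Nat.find (hinf n)
  have hnext : ∀ n, n ≤ next n ∧ o (next n) ≠ none := fun n => Nat.find_spec (hinf n)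
  have hmin : ∀ n m, n ≤ m → m < next n → o m = none := by
    intro n m h1 h2
    by_contra h3
    exact Nat.find_min (hinf n) h2 ⟨h1, h3⟩
  let t : ℕ → ℕ := fun i => Nat.rec (next 0) (fun _ m => next (m + 1)) i
  have ht : ∀ i, o (t i) ≠ none := by
    intro i
    cases i with
    | zero => exact (hnext _).2
    | succ i => exact (hnext _).2
  have hconst : ∀ n k, n + k ≤ next n → x (n + k) = x n := by
    intro n k
    induction k with
    | zero => intro _; rfl
    | succ k ih =>
      intro hk
      have h1 := h (n + k)
      rw [hmin n (n + k) (by omega) (by omega)] at h1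
      exact Eq.trans h1 (ih (by omega))
  have hxn : ∀ n, x (next n) = x n := by
    intro n
    have h1 := (hnext n).1
    have := hconst n (next n - n) (by omega)
    rwa [show n + (next n - n) = next n by omega] at this
  have hlt : ∀ i, t i < t (i + 1) := fun i => (hnext (t i + 1)).1
  have hmono : StrictMono t := strictMono_nat_of_lt_succ hlt
  have hcover : ∀ n, ∃ i, n ≤ t i ∧ ∀ m, n ≤ m → m < t i → o m = none := by
    intro n
    induction n with
    | zero => exact ⟨0, Nat.zero_le _, fun m h1 h2 => hmin 0 m h1 h2⟩
    | succ n ih =>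
      obtain ⟨i, h1, h2⟩ := ih
      rcases Nat.lt_or_ge n (t i) with h3 | h3
      · exact ⟨i, h3, fun m h4 h5 => h2 m (by omega) h5⟩
      · have : n = t i := le_antisymm h1 h3
        subst this
        exact ⟨i + 1, hlt i, fun m h4 h5 => hmin _ m h4 h5⟩
  choose d hd using fun i => Option.ne_none_iff_exists'.1 (ht i)
  refine ⟨fun i => x (t i), d, hxn 0, ?_, fun i => ⟨t i, rfl⟩, ?_, ?_⟩
  · intro i
    have h1 := h (t i)
    rw [hd i] at h1
    have h2 : x (t (i + 1)) = x (t i + 1) := hxn (t i + 1)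
    simp only [h2]
    exact h1
  · intro n
    obtain ⟨i, h1, h2⟩ := hcover n
    refine ⟨i, ?_⟩
    have : ∀ k, n + k ≤ t i → x (n + k) = x n := by
      intro k
      induction k with
      | zero => intro _; rfl
      | succ k ih =>
        intro hk
        have h3 := h (n + k)
        rw [h2 (n + k) (by omega) (by omega)] at h3
        exact Eq.trans h3 (ih (by omega))
    have := this (t i - n) (by omega)
    rw [show n + (t i - n) = t i by omega] at this
    exact this.symm
  · ext q
    constructor
    · intro hq n
      obtain ⟨i, hi, hdi⟩ := hq n
      exact ⟨t i, hi.trans (hmono.id_le i), by rw [hd i, hdi]⟩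
    · intro hq n
      obtain ⟨m, hm, ho⟩ := hq (t n)
      obtain ⟨i, h1, h2⟩ := hcover m
      have : m = t i := by
        rcases Nat.lt_or_ge m (t i) with h3 | h3
        · have := h2 m le_rfl h3
          rw [ho] at this; cases this
        · exact le_antisymm h1 h3
      subst this
      refine ⟨i, hmono.le_iff_le.1 hm, ?_⟩
      rw [hd i] at ho
      exact Option.some.inj ho

end Runs

section Words

variable {N T : Type*}

@[simp] theorem termPrefix_map_inr_append (w : List T) (y : List (N ⊕ T)) :
    termPrefix (w.map Sum.inr ++ y) = w ++ termPrefix y := by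
  induction w with
  | nil => rfl
  | cons a w ih => simp [termPrefix, ih]

@[simp] theorem termPrefix_map_inr (w : List T) :
    termPrefix (w.map Sum.inr : List (N ⊕ T)) = w := by
  simpa [termPrefix] using termPrefix_map_inr_append (N := N) w []

@[simp] theorem termPrefix_inl_cons (A : N) (y : List (N ⊕ T)) :
    termPrefix (Sum.inl A :: y) = [] := rfl

theorem terminal_or_exists_inl (x : List (N ⊕ T)) :
    (∃ w : List T, x = w.map Sum.inr) ∨
      ∃ (w : List T) (A : N) (y : List (N ⊕ T)), x = w.map Sum.inr ++ Sum.inl A :: y := by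
  induction x with
  | nil => exact Or.inl ⟨[], rfl⟩
  | cons s x ih =>
    cases s with
    | inl A => exact Or.inr ⟨[], A, x, rfl⟩
    | inr a =>
      rcases ih with ⟨w, rfl⟩ | ⟨w, A, y, rfl⟩
      · exact Or.inl ⟨a :: w, rfl⟩
      · exact Or.inr ⟨a :: w, A, y, rfl⟩

theorem termPrefix_prefix_append (x y : List (N ⊕ T)) :
    termPrefix x <+: termPrefix (x ++ y) := by
  rcases terminal_or_exists_inl x with ⟨w, rfl⟩ | ⟨w, A, z, rfl⟩
  · simp
  · simp

theorem map_inr_injective : Function.Injective (List.map (Sum.inr : T → N ⊕ T)) :=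
  List.map_injective_iff.2 Sum.inr_injective

theorem exists_of_append_eq_map_inr {x y : List (N ⊕ T)} {w : List T}
    (h : x ++ y = w.map Sum.inr) :
    ∃ w₁ w₂ : List T, w = w₁ ++ w₂ ∧ x = w₁.map Sum.inr ∧ y = w₂.map Sum.inr := by
  obtain ⟨w₁, w₂, h1, h2, h3⟩ := List.map_eq_append_iff.1 h.symm
  exact ⟨w₁, w₂, h1, h2.symm, h3.symm⟩

theorem MatchesPrefix.mono {l l' : List T} {u : ℕ → T} (h : MatchesPrefix l' u)
    (hl : l <+: l') : MatchesPrefix l u := by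
  intro k hk
  rw [← h k (hk.trans_le hl.length_le)]
  exact hl.getElem hk

theorem matchesPrefix_append {l l' : List T} {u : ℕ → T} :
    MatchesPrefix (l ++ l') u ↔
      MatchesPrefix l u ∧ MatchesPrefix l' (fun i => u (l.length + i)) := by
  constructor
  · intro h
    refine ⟨h.mono (List.prefix_append _ _), fun k hk => ?_⟩
    have := h (l.length + k) (by simp; omega)
    simpa using this
  · rintro ⟨h1, h2⟩ k hk
    rcases Nat.lt_or_ge k l.length with h3 | h3
    · simpa [List.getElem_append_left h3] using h1 k h3
    · have := h2 (k - l.length) (by simp at hk; omega)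
      simp only [List.get_eq_getElem] at this ⊢
      rw [List.getElem_append_right h3, this, show l.length + (k - l.length) = k by omega]

theorem MatchesPrefix.nil (u : ℕ → T) : MatchesPrefix [] u := fun k hk => by simp at hk

/-- The terminal prefixes of a sequence of sentential forms grow beyond every bound. -/
def Unbounded (x : ℕ → List (N ⊕ T)) : Prop := ∀ n : ℕ, ∃ i : ℕ, n ≤ (termPrefix (x i)).length

end Words

namespace OmegaPSG

variable {T : Type} {G : OmegaPSG T}

theorem LStep.step {p : G.P} {x y : List (G.N ⊕ T)} (h : G.LStep p x y) : G.Step p x y := by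
  obtain ⟨u, v, -, h1, h2⟩ := h
  exact ⟨u, v, h1, h2⟩

theorem StepOf.step {π : DerivMode} {p : G.P} {x y : List (G.N ⊕ T)} (h : G.StepOf π p x y) :
    G.Step p x y := by
  cases π with
  | l => exact LStep.step h
  | nl => exact h

theorem Step.append {p : G.P} {x y : List (G.N ⊕ T)} (h : G.Step p x y)
    (a b : List (G.N ⊕ T)) : G.Step p (a ++ x ++ b) (a ++ y ++ b) := by
  obtain ⟨u, v, rfl, rfl⟩ := h
  exact ⟨a ++ u, v ++ b, by simp, by simp⟩

theorem LStep.append {p : G.P} {x y : List (G.N ⊕ T)} (h : G.LStep p x y)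
    (w : List T) (b : List (G.N ⊕ T)) :
    G.LStep p (w.map Sum.inr ++ x ++ b) (w.map Sum.inr ++ y ++ b) := by
  obtain ⟨u, v, hu, rfl, rfl⟩ := h
  refine ⟨w.map Sum.inr ++ u, v ++ b, ?_, by simp, by simp⟩
  intro s hs
  rcases List.mem_append.1 hs with hs | hs
  · obtain ⟨a, -, rfl⟩ := List.mem_map.1 hs
    exact ⟨a, rfl⟩
  · exact hu s hs

theorem Step.isPrefix_termPrefix {p : G.P} {x y : List (G.N ⊕ T)} (h : G.Step p x y) :
    termPrefix x <+: termPrefix y := by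
  obtain ⟨u, v, rfl, rfl⟩ := h
  obtain ⟨A, l, hA⟩ := List.exists_cons_of_ne_nil (G.lhs_ne p)
  rcases terminal_or_exists_inl u with ⟨w, rfl⟩ | ⟨w, B, z, rfl⟩
  · simp [hA]
  · simp

/-- Finite derivations in the normal mode. -/
abbrev Derives (G : OmegaPSG T) : List G.P → List (G.N ⊕ T) → List (G.N ⊕ T) → Prop :=
  Der G.Step

theorem Derives.append {ps : List G.P} {x y : List (G.N ⊕ T)} (h : G.Derives ps x y)
    (a b : List (G.N ⊕ T)) : G.Derives ps (a ++ x ++ b) (a ++ y ++ b) := by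
  simpa using h.map (R' := G.Step) id (fun z => a ++ z ++ b) fun _ _ _ hs => hs.append a b

theorem Derives.append_right {ps : List G.P} {x y : List (G.N ⊕ T)} (h : G.Derives ps x y)
    (b : List (G.N ⊕ T)) : G.Derives ps (x ++ b) (y ++ b) := by simpa using h.append [] b

theorem Derives.append_left {ps : List G.P} {x y : List (G.N ⊕ T)} (h : G.Derives ps x y)
    (a : List (G.N ⊕ T)) : G.Derives ps (a ++ x) (a ++ y) := by simpa using h.append a []

theorem Derives.isPrefix_termPrefix {ps : List G.P} {x y : List (G.N ⊕ T)}
    (h : G.Derives ps x y) : termPrefix x <+: termPrefix y := by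
  induction h with
  | nil => exact List.prefix_rfl
  | cons hs _ ih => exact hs.isPrefix_termPrefix.trans ih

theorem Recurrent.append {Q Q' : Set G.P} {x y : List (G.N ⊕ T)}
    (h : Recurrent G.Step Q x) (h' : Recurrent G.Step Q' y) :
    Recurrent G.Step (Q ∪ Q') (x ++ y) := by
  obtain ⟨b, rfl, hb⟩ := h
  obtain ⟨c, rfl, hc⟩ := h'
  refine ⟨fun i => b i ++ c i, rfl, fun i => ?_⟩
  obtain ⟨ps, rfl, h1⟩ := hb i
  obtain ⟨qs, rfl, h2⟩ := hc i
  refine ⟨ps ++ qs, by ext q; simp, ?_⟩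
  exact Der.append (Derives.append_right h1 _) (Derives.append_left h2 _)

/-- Finite derivations may be strung together to show membership in the language. -/
theorem mem_lang_of_blocks {π : DerivMode} {ρ : AccRho} {u : ℕ → T}
    {x : ℕ → List (G.N ⊕ T)} {ps : ℕ → List G.P} (h₀ : x 0 = [Sum.inl G.start])
    (h : ∀ n, Der (G.StepOf π) (ps n) (x n) (x (n + 1))) (hunb : Unbounded x)
    (hu : ∀ n, MatchesPrefix (termPrefix (x n)) u)
    (hacc : ∃ F ∈ G.acc, rhoRel ρ {q | ∀ n : ℕ, ∃ m, n ≤ m ∧ q ∈ ps m} F) :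
    u ∈ G.Lang .inf ρ π := by
  obtain ⟨y, o, hy0, hrun, hxy, hyx, hinf⟩ := exists_run_of_blocks h
  have hnl : ∀ {qs a b}, Der (G.StepOf π) qs a b → G.Derives qs a b := fun hd => by
    simpa using hd.map (R' := G.Step) id id fun _ _ _ hs => hs.step
  have hmono : ∀ m k, termPrefix (y m) <+: termPrefix (y (m + k)) := fun m k =>
    (hnl (hrun.der m k)).isPrefix_termPrefix
  have hyunb : Unbounded y := by
    intro n
    obtain ⟨i, hi⟩ := hunb n
    obtain ⟨m, hm⟩ := hxy i
    exact ⟨m, by rwa [hm]⟩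
  have hsteps : ∀ n, ∃ m, n ≤ m ∧ o m ≠ none := by
    intro n
    by_contra hcon
    push Not at hcon
    have hconst : ∀ k, y (n + k) = y n := by
      intro k
      induction k with
      | zero => rfl
      | succ k ih =>
        have h1 := hrun (n + k)
        rw [hcon (n + k) (by omega)] at h1
        exact Eq.trans h1 ih
    obtain ⟨i, hi⟩ := hyunb ((termPrefix (y n)).length + 1)
    have h2 := (hmono i n).length_le
    rw [Nat.add_comm i n, hconst i] at h2
    omega
  obtain ⟨s, d, hs0, hs, hsy, hys, hd⟩ := exists_seq_of_run hrun hsteps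
  refine ⟨s, d, by rw [hs0, hy0, h₀], hs, ?_, ?_, ?_⟩
  · intro n
    obtain ⟨i, hi⟩ := hyunb n
    obtain ⟨j, hj⟩ := hys i
    exact ⟨j, by rwa [← hj]⟩
  · intro i
    obtain ⟨m, hm⟩ := hsy i
    obtain ⟨n, qs, hq⟩ := hyx m
    rw [hm]
    exact (hu n).mono (hnl hq).isPrefix_termPrefix
  · unfold IsAccepting
    rw [hd, hinf]
    exact hacc

/-- Membership of a word in the language, phrased by a run with pauses. -/
theorem exists_run_of_mem_lang {ρ : AccRho} {π : DerivMode} {u : ℕ → T}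
    (hu : u ∈ G.Lang .inf ρ π) :
    ∃ x o, x 0 = [Sum.inl G.start] ∧ IsRun G.Step x o ∧ Unbounded x ∧
      (∀ n, MatchesPrefix (termPrefix (x n)) u) ∧ ∃ F ∈ G.acc, rhoRel ρ (infOcc o) F := by
  obtain ⟨s, d, h0, hs, h1, h2, F, hF, h3⟩ := hu
  refine ⟨s, fun n => some (d n), h0, fun n => (hs n).step, h1, h2, F, hF, ?_⟩
  have : infOcc (fun n => some (d n)) = sigmaSet .inf d := by
    ext q; simp [infOcc, sigmaSet]
  rwa [this]

theorem step_of_lhs_eq {p : G.P} {X : G.N} (h : G.lhs p = [X]) :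
    G.Step p [Sum.inl X] (G.rhs p) := ⟨[], [], by simp [h], by simp⟩

theorem exists_lhs_eq (hG : G.IsCFG) (p : G.P) : ∃ A, G.lhs p = [A] :=
  List.length_eq_one_iff.1 (hG p)

theorem Step.split (hG : G.IsCFG) {p : G.P} {a b y : List (G.N ⊕ T)} (h : G.Step p (a ++ b) y) :
    (∃ a', G.Step p a a' ∧ y = a' ++ b) ∨ ∃ b', G.Step p b b' ∧ y = a ++ b' := by
  obtain ⟨u, v, h1, rfl⟩ := h
  obtain ⟨A, hA⟩ := exists_lhs_eq hG p
  rw [hA] at h1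
  simp only [List.map_cons, List.map_nil, List.append_assoc, List.cons_append,
    List.nil_append] at h1
  rcases List.append_eq_append_iff.1 h1 with ⟨c, rfl, rfl⟩ | ⟨c, rfl, hc⟩
  · exact Or.inr ⟨c ++ G.rhs p ++ v, ⟨c, v, by simp [hA], rfl⟩, by simp⟩
  · cases c with
    | nil =>
      simp only [List.nil_append] at hc
      exact Or.inr ⟨G.rhs p ++ v, ⟨[], v, by simp [hA, ← hc], by simp⟩, by simp⟩
    | cons s c =>
      obtain ⟨rfl, rfl⟩ := List.cons.inj hc
      exact Or.inl ⟨u ++ G.rhs p ++ c, ⟨u, c, by simp [hA], rfl⟩, by simp⟩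

theorem not_step_map_inr (hG : G.IsCFG) {p : G.P} {w : List T} {y : List (G.N ⊕ T)} :
    ¬ G.Step p (w.map Sum.inr) y := by
  rintro ⟨u, v, h1, -⟩
  obtain ⟨A, hA⟩ := exists_lhs_eq hG p
  rw [hA] at h1
  have : (Sum.inl A : G.N ⊕ T) ∈ (w.map Sum.inr : List (G.N ⊕ T)) := by rw [h1]; simp
  simp at this

theorem step_singleton (hG : G.IsCFG) {p : G.P} {X : G.N} {y : List (G.N ⊕ T)}
    (h : G.Step p [Sum.inl X] y) : G.lhs p = [X] ∧ y = G.rhs p := by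
  obtain ⟨u, v, h1, rfl⟩ := h
  obtain ⟨A, hA⟩ := exists_lhs_eq hG p
  rw [hA] at h1
  have hlen := congrArg List.length h1
  simp only [List.length_append, List.length_map, List.length_cons, List.length_nil] at hlen
  have hu : u = [] := List.eq_nil_of_length_eq_zero (by omega)
  have hv : v = [] := List.eq_nil_of_length_eq_zero (by omega)
  subst hu hv
  simp at h1
  simp [hA, h1]

theorem Derives.eq_of_map_inr (hG : G.IsCFG) {ps : List G.P} {w : List T} {y : List (G.N ⊕ T)}
    (h : G.Derives ps (w.map Sum.inr) y) : ps = [] ∧ y = w.map Sum.inr := by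
  cases h with
  | nil => exact ⟨rfl, rfl⟩
  | cons hs _ => exact absurd hs (not_step_map_inr hG)

theorem Derives.split (hG : G.IsCFG) {ps : List G.P} {a b z : List (G.N ⊕ T)}
    (h : G.Derives ps (a ++ b) z) :
    ∃ ps₁ ps₂ z₁ z₂, z = z₁ ++ z₂ ∧ G.Derives ps₁ a z₁ ∧ G.Derives ps₂ b z₂ ∧
      (∀ q, q ∈ ps ↔ q ∈ ps₁ ∨ q ∈ ps₂) ∧ ps.length = ps₁.length + ps₂.length := by
  induction ps generalizing a b with
  | nil => exact ⟨[], [], a, b, h.eq_of_nil.symm, .nil _, .nil _, by simp, rfl⟩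
  | cons p ps ih =>
    cases h with
    | cons hs hd =>
      rcases hs.split hG with ⟨a', h1, rfl⟩ | ⟨b', h1, rfl⟩
      · obtain ⟨ps₁, ps₂, z₁, z₂, rfl, h2, h3, h4, h5⟩ := ih hd
        refine ⟨p :: ps₁, ps₂, z₁, z₂, rfl, .cons h1 h2, h3, ?_, ?_⟩
        · intro q; simp [h4, or_assoc]
        · simp [h5]; omega
      · obtain ⟨ps₁, ps₂, z₁, z₂, rfl, h2, h3, h4, h5⟩ := ih hd
        refine ⟨ps₁, p :: ps₂, z₁, z₂, rfl, h2, .cons h1 h3, ?_, ?_⟩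
        · intro q; simp only [List.mem_cons, h4]; tauto
        · simp [h5]; omega

/-- A derivation of a terminal word from a nonterminal starts with one of its productions. -/
theorem Derives.of_singleton (hG : G.IsCFG) {ps : List G.P} {X : G.N} {w : List T}
    (h : G.Derives ps [Sum.inl X] (w.map Sum.inr)) :
    ∃ p ps', ps = p :: ps' ∧ G.lhs p = [X] ∧ G.Derives ps' (G.rhs p) (w.map Sum.inr) := by
  generalize hz : (w.map Sum.inr : List (G.N ⊕ T)) = z at h
  cases h with
  | nil => cases w <;> simp at hz
  | cons hs hd =>
    obtain ⟨h1, rfl⟩ := step_singleton hG hs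
    exact ⟨_, _, rfl, h1, hd⟩

/-- A run from a concatenation splits into two simultaneous runs. -/
theorem IsRun.split (hG : G.IsCFG) {x : ℕ → List (G.N ⊕ T)} {o : ℕ → Option G.P}
    (h : IsRun G.Step x o)
    {a b : List (G.N ⊕ T)} (h₀ : x 0 = a ++ b) :
    ∃ x₁ o₁ x₂ o₂, IsRun G.Step x₁ o₁ ∧ IsRun G.Step x₂ o₂ ∧ x₁ 0 = a ∧ x₂ 0 = b ∧
      (∀ n, x n = x₁ n ++ x₂ n) ∧ ∀ n q, o n = some q ↔ o₁ n = some q ∨ o₂ n = some q := by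
  obtain ⟨f, hf0, hf⟩ := exists_seq (S := List (G.N ⊕ T) × List (G.N ⊕ T))
    (Inv := fun n s => x n = s.1 ++ s.2)
    (Rel := fun n s s' => ∃ o₁ o₂, OStep G.Step o₁ s.1 s'.1 ∧
      OStep G.Step o₂ s.2 s'.2 ∧ ∀ q, o n = some q ↔ o₁ = some q ∨ o₂ = some q)
    (s₀ := (a, b)) h₀ (by
      rintro n ⟨c, e⟩ hm
      have hs := h n
      simp only at hm
      rw [hm] at hs
      cases ho : o n with
      | none =>
        rw [ho] at hs
        exact ⟨(c, e), ⟨none, none, rfl, rfl, by simp⟩, hs⟩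
      | some p =>
        rw [ho] at hs
        rcases Step.split hG hs with ⟨c', h1, h2⟩ | ⟨e', h1, h2⟩
        · exact ⟨(c', e), ⟨some p, none, h1, rfl, by simp⟩, h2⟩
        · exact ⟨(c, e'), ⟨none, some p, rfl, h1, by simp⟩, h2⟩)
  choose o₁ o₂ h1 h2 h3 using fun n => (hf n).2
  exact ⟨fun n => (f n).1, o₁, fun n => (f n).2, o₂, h1, h2, by simp only [hf0],
    by simp only [hf0], fun n => (hf n).1, h3⟩

theorem not_unbounded_of_eq_map_inr (hG : G.IsCFG) {x : ℕ → List (G.N ⊕ T)} {o : ℕ → Option G.P}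
    (h : IsRun G.Step x o) {n : ℕ} {w : List T} (hw : x n = w.map Sum.inr) : ¬ Unbounded x := by
  intro hunb
  obtain ⟨i, hi⟩ := hunb (w.length + 1)
  have h1 := (Derives.isPrefix_termPrefix (h.der i n)).length_le
  have h2 := h.der n i
  rw [hw] at h2
  rw [Nat.add_comm i n, (Derives.eq_of_map_inr hG h2).2, termPrefix_map_inr] at h1
  omega

/-- In a run generating an infinite word, exactly one symbol of the initial sentential form
generates infinitely many letters after the symbols to its left have been used up. -/
theorem IsRun.exists_spine (hG : G.IsCFG) (a : List (G.N ⊕ T)) {x : ℕ → List (G.N ⊕ T)}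
    {o : ℕ → Option G.P} (h : IsRun G.Step x o) (h₀ : x 0 = a) (hunb : Unbounded x) :
    ∃ (α : List (G.N ⊕ T)) (Z : G.N) (δ : List (G.N ⊕ T)) (ps : List G.P) (w : List T)
      (x₂ : ℕ → List (G.N ⊕ T)) (o₂ : ℕ → Option G.P)
      (x₃ : ℕ → List (G.N ⊕ T)) (o₃ : ℕ → Option G.P),
      a = α ++ Sum.inl Z :: δ ∧ G.Derives ps α (w.map Sum.inr) ∧ IsRun G.Step x₂ o₂ ∧
      IsRun G.Step x₃ o₃ ∧ x₂ 0 = [Sum.inl Z] ∧ x₃ 0 = δ ∧ Unbounded x₂ ∧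
      (∀ q ∈ ps, ∃ n, o n = some q) ∧
      (∀ n q, o n = some q → q ∈ ps ∨ o₂ n = some q ∨ o₃ n = some q) ∧
      (∀ n q, o₂ n = some q ∨ o₃ n = some q → o n = some q) ∧
      (∃ n₀, ∀ n, n₀ ≤ n → ∀ q, o n = some q → o₂ n = some q ∨ o₃ n = some q) ∧
      (∃ n₀, ∀ n, n₀ ≤ n → x n = w.map Sum.inr ++ x₂ n ++ x₃ n) ∧
      ∀ n, (termPrefix (x n)).length ≤ w.length + (termPrefix (x₂ n)).length := by
  induction a generalizing x o with
  | nil => exact absurd hunb (not_unbounded_of_eq_map_inr hG h (n := 0) (w := []) h₀)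
  | cons s a ih =>
    obtain ⟨y, oy, z, oz, hy, hz, hy0, hz0, hx, ho⟩ :=
      IsRun.split hG h (a := [s]) (b := a) (by simpa using h₀)
    by_cases hub : Unbounded y
    · cases s with
      | inl Z =>
        refine ⟨[], Z, a, [], [], y, oy, z, oz, rfl, .nil _, hy, hz, hy0, hz0, hub, by simp,
          fun n q hq => Or.inr ((ho n q).1 hq), fun n q => (ho n q).2,
          ⟨0, fun n _ q => (ho n q).1⟩, ⟨0, fun n _ => by simpa using hx n⟩, fun n => ?_⟩
        rw [hx n]
        rcases terminal_or_exists_inl (y n) with ⟨w, hw⟩ | ⟨w, A, r, hw⟩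
        · exact absurd hub (not_unbounded_of_eq_map_inr hG hy hw)
        · simp [hw]
      | inr c => exact absurd hub (not_unbounded_of_eq_map_inr hG hy (n := 0) (w := [c]) hy0)
    · unfold Unbounded at hub
      push Not at hub
      obtain ⟨B, hB⟩ := hub
      have hterm : ∃ (n : ℕ) (w : List T), y n = List.map Sum.inr w := by
        obtain ⟨i, hi⟩ := hunb B
        rcases terminal_or_exists_inl (y i) with ⟨w, hw⟩ | ⟨w, A, r, hw⟩
        · exact ⟨i, w, hw⟩
        · have := hB i
          rw [hx, hw] at hi
          rw [hw] at this
          simp at hi this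
          omega
      obtain ⟨n₀, w, hw⟩ := hterm
      have hyk : ∀ n, n₀ ≤ n → y n = w.map Sum.inr := by
        intro n hn
        have := hy.der n₀ (n - n₀)
        rw [hw, show n₀ + (n - n₀) = n by omega] at this
        exact (Derives.eq_of_map_inr hG this).2
      have hoy : ∀ n, n₀ ≤ n → oy n = none := by
        intro n hn
        have := hy n
        cases ho : oy n with
        | none => rfl
        | some q =>
          rw [ho, hyk n hn] at this
          exact absurd this (not_step_map_inr hG)
      have hzunb : Unbounded z := by
        intro n
        obtain ⟨i, hi⟩ := hunb (w.length + n)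
        refine ⟨i + n₀, ?_⟩
        have h1 := (Derives.isPrefix_termPrefix (h.der i n₀)).length_le
        rw [hx (i + n₀), hyk (i + n₀) (by omega)] at h1
        simp at h1
        omega
      obtain ⟨α, Z, δ, ps, w', x₂, o₂, x₃, o₃, rfl, h1, h2, h3, h4, h5, h6, h7, h8, h9,
        ⟨n₁, h10⟩, ⟨n₂, h11⟩, h12⟩ := ih hz hz0 hzunb
      have hd : G.Derives (labels oy 0 n₀) [s] (w.map Sum.inr) := by
        have := hy.der 0 n₀
        rwa [hy0, Nat.zero_add, hw] at this
      refine ⟨s :: α, Z, δ, labels oy 0 n₀ ++ ps, w ++ w', x₂, o₂, x₃, o₃, rfl, ?_, h2, h3, h4,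
        h5, h6, ?_, ?_, ?_, ⟨max n₀ n₁, ?_⟩, ⟨max n₀ n₂, ?_⟩, ?_⟩
      · have := Der.append (Derives.append_right hd α) (Derives.append_left h1 (w.map Sum.inr))
        simpa using this
      · intro q hq
        rcases List.mem_append.1 hq with hq | hq
        · obtain ⟨j, -, -, hj⟩ := mem_labels.1 hq
          exact ⟨j, (ho j q).2 (Or.inl hj)⟩
        · obtain ⟨n, hn⟩ := h7 q hq
          exact ⟨n, (ho n q).2 (Or.inr hn)⟩
      · intro n q hq
        rcases (ho n q).1 hq with hq | hq
        · left
          refine List.mem_append_left _ (mem_labels.2 ⟨n, Nat.zero_le _, ?_, hq⟩)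
          by_contra hn
          rw [hoy n (by omega)] at hq
          cases hq
        · rcases h8 n q hq with hq | hq
          · exact Or.inl (List.mem_append_right _ hq)
          · exact Or.inr hq
      · exact fun n q hq => (ho n q).2 (Or.inr (h9 n q hq))
      · intro n hn q hq
        rcases (ho n q).1 hq with hq | hq
        · rw [hoy n (le_of_max_le_left hn)] at hq
          cases hq
        · exact h10 n (le_of_max_le_right hn) q hq
      · intro n hn
        rw [hx n, hyk n (le_of_max_le_left hn), h11 n (le_of_max_le_right hn)]
        simp
      · intro n
        have h13 := (Derives.isPrefix_termPrefix (hy.der n n₀)).length_le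
        rw [hyk (n + n₀) (by omega), termPrefix_map_inr] at h13
        have h14 := h12 n
        rw [hx n]
        rcases terminal_or_exists_inl (y n) with ⟨v, hv⟩ | ⟨v, A, r, hv⟩
        · simp [hv] at h13 ⊢
          omega
        · simp [hv] at h13 ⊢
          omega

end OmegaPSG

theorem infOcc_eq_union {P : Type*} {o o₁ o₂ : ℕ → Option P}
    (h : ∀ n q, o₁ n = some q ∨ o₂ n = some q → o n = some q)
    (h' : ∃ n₀, ∀ n, n₀ ≤ n → ∀ q, o n = some q → o₁ n = some q ∨ o₂ n = some q) :
    infOcc o = infOcc o₁ ∪ infOcc o₂ := by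
  obtain ⟨n₀, h'⟩ := h'
  ext q
  constructor
  · intro hq
    by_contra hcon
    simp only [infOcc, Set.mem_union, Set.mem_ofPred_eq, not_or, not_forall, not_exists,
      not_and] at hcon
    obtain ⟨⟨n₁, h1⟩, n₂, h2⟩ := hcon
    obtain ⟨m, hm, hq⟩ := hq (n₀ + n₁ + n₂)
    rcases h' m (by omega) q hq with h3 | h3
    · exact h1 m (by omega) h3
    · exact h2 m (by omega) h3
  · rintro (hq | hq) n
    · obtain ⟨m, hm, hq⟩ := hq n
      exact ⟨m, hm, h m q (Or.inl hq)⟩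
    · obtain ⟨m, hm, hq⟩ := hq n
      exact ⟨m, hm, h m q (Or.inr hq)⟩

namespace OmegaPSG

variable {T : Type} {G : OmegaPSG T}

instance (G : OmegaPSG T) : Finite G.P := by
  have := G.fintypeP
  infer_instance

instance (G : OmegaPSG T) : Finite G.N := by
  have := G.fintypeN
  infer_instance

/-- One node `Y` of the infinite path of a derivation tree that generates the ω-word: `p`
rewrites `Y` to `α Z δ`, the symbols `α` to the left of the path derive the terminal word `w`
by `ps`, and those to its right derive `δ'` by `vs`, after which exactly the productions in `R`
recur. -/
structure Level (G : OmegaPSG T) where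
  Y : G.N
  p : G.P
  α : List (G.N ⊕ T)
  δ : List (G.N ⊕ T)
  δ' : List (G.N ⊕ T)
  ps : List G.P
  vs : List G.P
  w : List T
  R : Set G.P

/-- The level `l` describes derivations of `G`, and the path continues with `Z`. -/
structure Level.Valid (l : Level G) (Z : G.N) : Prop where
  lhs : G.lhs l.p = [l.Y]
  rhs : G.rhs l.p = l.α ++ Sum.inl Z :: l.δ
  der : G.Derives l.ps l.α (l.w.map Sum.inr)
  tail : G.Derives l.vs l.δ l.δ'
  recurrent : Recurrent G.Step l.R l.δ'

/-- The productions used finitely often at a level. -/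
def Level.label (l : Level G) : Set G.P := {q | q = l.p ∨ q ∈ l.ps ∨ q ∈ l.vs}

/-- The levels form an infinite path. -/
def IsSpine (l : ℕ → Level G) : Prop := ∀ k, (l k).Valid (l (k + 1)).Y

/-- The terminal word generated to the left of level `k`. -/
def spineWord (l : ℕ → Level G) (k : ℕ) : List T := (List.range k).flatMap fun j => (l j).w

/-- The productions used infinitely often along a path and beside it. -/
def spineInf (l : ℕ → Level G) : Set G.P :=
  {q | ∀ n : ℕ, ∃ k, n ≤ k ∧ q ∈ (l k).label} ∪ ⋃ k, (l k).R

@[simp] theorem spineWord_zero (l : ℕ → Level G) : spineWord l 0 = [] := rfl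

theorem spineWord_succ (l : ℕ → Level G) (k : ℕ) :
    spineWord l (k + 1) = spineWord l k ++ (l k).w := by
  simp [spineWord, List.range_succ]

theorem spineWord_add (l : ℕ → Level G) (m k : ℕ) :
    spineWord l (m + k) = spineWord l m ++ spineWord (fun j => l (m + j)) k := by
  induction k with
  | zero => simp
  | succ k ih => rw [← Nat.add_assoc, spineWord_succ, ih, spineWord_succ, List.append_assoc]

/-- The first node of a run generating an infinite word. -/
theorem exists_level (hG : G.IsCFG) {Y : G.N} {x : ℕ → List (G.N ⊕ T)} {o : ℕ → Option G.P}
    {u : ℕ → T} (h : IsRun G.Step x o) (h₀ : x 0 = [Sum.inl Y]) (hunb : Unbounded x)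
    (hu : ∀ n, MatchesPrefix (termPrefix (x n)) u) :
    ∃ (l : Level G) (Z : G.N) (x' : ℕ → List (G.N ⊕ T)) (o' : ℕ → Option G.P),
      l.Y = Y ∧ l.Valid Z ∧ IsRun G.Step x' o' ∧ x' 0 = [Sum.inl Z] ∧ Unbounded x' ∧
      MatchesPrefix l.w u ∧
      (∀ n, MatchesPrefix (termPrefix (x' n)) fun i => u (l.w.length + i)) ∧
      (∀ q ∈ l.label, ∃ m, o m = some q) ∧
      (∀ m q, o' m = some q → ∃ m', m < m' ∧ o m' = some q) ∧
      (∀ m q, o m = some q → q ∈ l.label ∨ q ∈ l.R ∨ ∃ m', m' < m ∧ o' m' = some q) ∧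
      infOcc o = l.R ∪ infOcc o' ∧
      ∀ n, (termPrefix (x n)).length = 0 ∨ ∃ n', n' < n ∧
        (termPrefix (x n)).length ≤ l.w.length + (termPrefix (x' n')).length := by
  classical
  have hex : ∃ m, o m ≠ none := by
    by_contra hcon
    push Not at hcon
    have hconst : ∀ n, x n = [Sum.inl Y] := by
      intro n
      induction n with
      | zero => exact h₀
      | succ n ih =>
        have h1 := h n
        rw [hcon n] at h1
        exact Eq.trans h1 ih
    obtain ⟨i, hi⟩ := hunb 1
    simp [hconst i] at hi
  set m := Nat.find hex with hm
  have hmin : ∀ n, n < m → o n = none := fun n hn => by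
    by_contra hcon
    exact Nat.find_min hex hn hcon
  have hconst : ∀ n, n ≤ m → x n = [Sum.inl Y] := by
    intro n
    induction n with
    | zero => exact fun _ => h₀
    | succ n ih =>
      intro hn
      have h1 := h n
      rw [hmin n (by omega)] at h1
      exact Eq.trans h1 (ih (by omega))
  obtain ⟨p, hp⟩ := Option.ne_none_iff_exists'.1 (Nat.find_spec hex)
  rw [← hm] at hp
  have hstep := h m
  rw [hp, hconst m le_rfl] at hstep
  obtain ⟨hlhs, hrhs⟩ := step_singleton hG hstep
  have hsunb : Unbounded fun n => x (n + (m + 1)) := by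
    intro n
    obtain ⟨i, hi⟩ := hunb n
    exact ⟨i, hi.trans (Derives.isPrefix_termPrefix (h.der i (m + 1))).length_le⟩
  obtain ⟨α, Z, δ, ps, w, x₂, o₂, x₃, o₃, e1, e2, e3, e4, e5, e6, e7, e8, e9, e10, e11,
    ⟨n₁, e12⟩, e13⟩ := IsRun.exists_spine hG (G.rhs p) (h.shift (m + 1))
      (by simpa using hrhs) hsunb
  obtain ⟨vs, δ', f1, f2, f3, f4⟩ := e4.exists_recurrent
  have hmatch : ∀ n, MatchesPrefix (w ++ termPrefix (x₂ n)) u := by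
    intro n
    have h1 := e12 (n + n₁) (by omega)
    have h2 := hu (n + n₁ + (m + 1))
    rw [h1, List.append_assoc, termPrefix_map_inr_append] at h2
    refine h2.mono ((List.prefix_append_right_inj w).2 ?_)
    exact (Derives.isPrefix_termPrefix (e3.der n n₁)).trans (termPrefix_prefix_append _ _)
  refine ⟨⟨Y, p, α, δ, δ', ps, vs, w, infOcc o₃⟩, Z, x₂, o₂, rfl,
    ⟨hlhs, e1, e2, by rwa [e6] at f1, f2⟩, e3, e5, e7, (matchesPrefix_append.1 (hmatch 0)).1,
    fun n => (matchesPrefix_append.1 (hmatch n)).2, ?_, ?_, ?_, ?_, ?_⟩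
  · rintro q (rfl | hq | hq)
    · exact ⟨m, hp⟩
    · obtain ⟨n, hn⟩ := e8 q hq
      exact ⟨_, hn⟩
    · obtain ⟨n, hn⟩ := f3 q hq
      exact ⟨_, e10 n q (Or.inr hn)⟩
  · intro n q hq
    exact ⟨n + (m + 1), by omega, e10 n q (Or.inl hq)⟩
  · intro n q hq
    rcases Nat.lt_trichotomy n m with hn | hn | hn
    · rw [hmin n hn] at hq
      cases hq
    · rw [hn, hp] at hq
      exact Or.inl (Or.inl (Option.some.inj hq).symm)
    · rcases e9 (n - (m + 1)) q (by simpa [show n - (m + 1) + (m + 1) = n by omega] using hq)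
        with hq | hq | hq
      · exact Or.inl (Or.inr (Or.inl hq))
      · exact Or.inr (Or.inr ⟨_, by omega, hq⟩)
      · rcases f4 q _ hq with hq | hq
        · exact Or.inl (Or.inr (Or.inr hq))
        · exact Or.inr (Or.inl hq)
  · rw [← infOcc_shift o (m + 1), infOcc_eq_union e10 e11, Set.union_comm]
  · intro n
    rcases Nat.lt_or_ge m n with hn | hn
    · refine Or.inr ⟨n - (m + 1), by omega, ?_⟩
      have := e13 (n - (m + 1))
      simpa only [show n - (m + 1) + (m + 1) = n by omega] using this
    · left
      simp [hconst n hn]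

/-- Every word of the language is generated along an infinite path. -/
theorem exists_isSpine_of_mem_lang (hG : G.IsCFG) {ρ : AccRho} {π : DerivMode} {u : ℕ → T}
    (hu : u ∈ G.Lang .inf ρ π) :
    ∃ l : ℕ → Level G, IsSpine l ∧ (l 0).Y = G.start ∧
      (∀ n, ∃ k, n ≤ (spineWord l k).length) ∧ (∀ k, MatchesPrefix (spineWord l k) u) ∧
      ∃ F ∈ G.acc, rhoRel ρ (spineInf l) F := by
  obtain ⟨x, o, h0, hrun, hunb, hmat, hacc⟩ := exists_run_of_mem_lang hu
  let St := G.N × (ℕ → List (G.N ⊕ T)) × (ℕ → Option G.P) × (ℕ → T)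
  obtain ⟨f, hf0, hf⟩ := exists_seq (S := St)
    (Inv := fun _ s => IsRun G.Step s.2.1 s.2.2.1 ∧ s.2.1 0 = [Sum.inl s.1] ∧
      Unbounded s.2.1 ∧ ∀ n, MatchesPrefix (termPrefix (s.2.1 n)) s.2.2.2)
    (Rel := fun _ s s' => ∃ l : Level G, l.Y = s.1 ∧ l.Valid s'.1 ∧
      MatchesPrefix l.w s.2.2.2 ∧ (s'.2.2.2 = fun i => s.2.2.2 (l.w.length + i)) ∧
      (∀ q ∈ l.label, ∃ m, s.2.2.1 m = some q) ∧
      (∀ m q, s'.2.2.1 m = some q → ∃ m', m < m' ∧ s.2.2.1 m' = some q) ∧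
      (∀ m q, s.2.2.1 m = some q →
        q ∈ l.label ∨ q ∈ l.R ∨ ∃ m', m' < m ∧ s'.2.2.1 m' = some q) ∧
      infOcc s.2.2.1 = l.R ∪ infOcc s'.2.2.1 ∧
      ∀ n, (termPrefix (s.2.1 n)).length = 0 ∨ ∃ n', n' < n ∧
        (termPrefix (s.2.1 n)).length ≤ l.w.length + (termPrefix (s'.2.1 n')).length)
    (s₀ := (G.start, x, o, u)) ⟨hrun, h0, hunb, hmat⟩ (by
      rintro - ⟨Y, x, o, u⟩ ⟨h1, h2, h3, h4⟩
      obtain ⟨l, Z, x', o', e1, e2, e3, e4, e5, e6, e7, e8, e9, e10, e11, e12⟩ :=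
        exists_level hG h1 h2 h3 h4
      exact ⟨(Z, x', o', fun i => u (l.w.length + i)),
        ⟨l, e1, e2, e6, rfl, e8, e9, e10, e11, e12⟩, e3, e4, e5, e7⟩)
  choose l e1 e2 e6 eu e8 e9 e10 e11 e12 using fun n => (hf n).2
  have hword : ∀ k, MatchesPrefix (spineWord l k) u ∧
      (f k).2.2.2 = fun i => u ((spineWord l k).length + i) := by
    intro k
    induction k with
    | zero => exact ⟨MatchesPrefix.nil u, by simp [hf0]⟩
    | succ k ih =>
      rw [spineWord_succ, matchesPrefix_append]
      have := e6 k
      rw [ih.2] at this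
      refine ⟨⟨ih.1, this⟩, ?_⟩
      rw [eu k, ih.2]
      simp [Nat.add_assoc]
  have hgrow : ∀ n k, ∃ m, (spineWord l k).length + (termPrefix ((f k).2.1 n)).length ≤
      (spineWord l m).length := by
    intro n
    induction n using Nat.strong_induction_on with
    | _ n ih =>
      intro k
      rcases e12 k n with h1 | ⟨n', hn', h1⟩
      · exact ⟨k, by omega⟩
      · obtain ⟨m, hm⟩ := ih n' hn' (k + 1)
        rw [spineWord_succ, List.length_append] at hm
        exact ⟨m, by omega⟩
  have hocc : ∀ k m q, (f k).2.2.1 m = some q → ∃ m', m + k ≤ m' ∧ o m' = some q := by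
    intro k
    induction k with
    | zero =>
      intro m q hq
      rw [hf0] at hq
      exact ⟨m, le_rfl, hq⟩
    | succ k ih =>
      intro m q hq
      obtain ⟨m', h1, h2⟩ := e9 k m q hq
      obtain ⟨m'', h3, h4⟩ := ih m' q h2
      exact ⟨m'', by omega, h4⟩
  have hinf : ∀ k, infOcc o = (⋃ j, ⋃ _ : j < k, (l j).R) ∪ infOcc (f k).2.2.1 := by
    intro k
    induction k with
    | zero => simp [hf0]
    | succ k ih =>
      rw [ih, e11 k, ← Set.union_assoc]
      congr 1
      ext q
      simp only [Set.mem_union, Set.mem_iUnion, Nat.lt_succ_iff_lt_or_eq]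
      constructor
      · rintro (⟨j, hj, hq⟩ | hq)
        · exact ⟨j, Or.inl hj, hq⟩
        · exact ⟨k, Or.inr rfl, hq⟩
      · rintro ⟨j, hj | rfl, hq⟩
        · exact Or.inl ⟨j, hj, hq⟩
        · exact Or.inr hq
  have hlater : ∀ m k q, (f k).2.2.1 m = some q →
      ∃ j, k ≤ j ∧ (q ∈ (l j).label ∨ q ∈ (l j).R) := by
    intro m
    induction m using Nat.strong_induction_on with
    | _ m ih =>
      intro k q hq
      rcases e10 k m q hq with h1 | h1 | ⟨m', h1, h2⟩
      · exact ⟨k, le_rfl, Or.inl h1⟩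
      · exact ⟨k, le_rfl, Or.inr h1⟩
      · obtain ⟨j, h3, h4⟩ := ih m' h1 (k + 1) q h2
        exact ⟨j, by omega, h4⟩
  have hset : spineInf l = infOcc o := by
    ext q
    constructor
    · rintro (hq | hq)
      · intro n
        obtain ⟨k, hk, hq⟩ := hq n
        obtain ⟨m, hm⟩ := e8 k q hq
        obtain ⟨m', h1, h2⟩ := hocc k m q hm
        exact ⟨m', by omega, h2⟩
      · obtain ⟨k, hq⟩ := Set.mem_iUnion.1 hq
        rw [hinf (k + 1)]
        exact Or.inl (Set.mem_iUnion₂.2 ⟨k, Nat.lt_succ_self k, hq⟩)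
    · intro hq
      by_cases hR : q ∈ ⋃ k, (l k).R
      · exact Or.inr hR
      · left
        intro n
        have h1 := hq
        rw [hinf n] at h1
        rcases h1 with h1 | h1
        · obtain ⟨j, -, h2⟩ := Set.mem_iUnion₂.1 h1
          exact absurd (Set.mem_iUnion.2 ⟨j, h2⟩) hR
        · obtain ⟨m, -, hm⟩ := h1 0
          obtain ⟨j, h2, h3 | h3⟩ := hlater m n q hm
          · exact ⟨j, h2, h3⟩
          · exact absurd (Set.mem_iUnion.2 ⟨j, h3⟩) hR
  refine ⟨l, fun k => ?_, by rw [e1 0, hf0], fun n => ?_, fun k => (hword k).1, ?_⟩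
  · have := e2 k
    rwa [← e1 (k + 1)] at this
  · obtain ⟨i, hi⟩ := hunb n
    obtain ⟨m, hm⟩ := hgrow i 0
    rw [hf0] at hm
    simp at hm
    exact ⟨m, by omega⟩
  · rwa [hset]

/-- The derivation along a path, with a recurrent sentential form behind it. -/
theorem IsSpine.exists_blocks {l : ℕ → Level G} (hl : IsSpine l) {r : List (G.N ⊕ T)}
    {Q : Set G.P} (hr : Recurrent G.Step Q r) :
    ∃ (f : ℕ → List (G.N ⊕ T)) (qs : ℕ → List G.P), f 0 = r ∧
      (∀ k, Recurrent G.Step ((⋃ j, ⋃ _ : j < k, (l j).R) ∪ Q) (f k)) ∧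
      (∀ k, G.Derives (qs k) ((spineWord l k).map Sum.inr ++ Sum.inl (l k).Y :: f k)
        ((spineWord l (k + 1)).map Sum.inr ++ Sum.inl (l (k + 1)).Y :: f (k + 1))) ∧
      {q | ∀ n : ℕ, ∃ m, n ≤ m ∧ q ∈ qs m} = spineInf l ∪ Q := by
  obtain ⟨f, hf0, hf⟩ := exists_seq (S := List (G.N ⊕ T))
    (Inv := fun k s => Recurrent G.Step ((⋃ j, ⋃ _ : j < k, (l j).R) ∪ Q) s)
    (Rel := fun k s s' => ∃ qs : List G.P,
      {q | q ∈ qs} = (l k).label ∪ ((⋃ j, ⋃ _ : j < k, (l j).R) ∪ Q) ∧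
      G.Derives qs (Sum.inl (l k).Y :: s) ((l k).w.map Sum.inr ++ Sum.inl (l (k + 1)).Y :: s'))
    (s₀ := r) (by simpa using hr) (by
      intro k s hs
      obtain ⟨qs, s', h1, h2, h3⟩ := hs.next
      have hk := hl k
      refine ⟨(l k).δ' ++ s', ⟨(l k).p :: ((l k).ps ++ ((l k).vs ++ qs)), ?_, ?_⟩, ?_⟩
      · rw [← h1]
        ext q
        simp [Level.label, or_assoc]
      · refine .cons (y := (l k).α ++ (Sum.inl (l (k + 1)).Y :: (l k).δ ++ s)) ?_ ?_
        · have := (step_of_lhs_eq hk.lhs).append [] s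
          simpa [hk.rhs] using this
        · refine Der.append (Derives.append_right hk.der _) ?_
          refine Der.append (y := (l k).w.map Sum.inr ++ Sum.inl (l (k + 1)).Y ::
            ((l k).δ' ++ s)) ?_ ?_
          · have := Derives.append hk.tail ((l k).w.map Sum.inr ++ [Sum.inl (l (k + 1)).Y]) s
            simpa only [List.append_assoc, List.cons_append, List.nil_append] using this
          · have := Derives.append_left h2
              ((l k).w.map Sum.inr ++ Sum.inl (l (k + 1)).Y :: (l k).δ')
            simpa only [List.append_assoc, List.cons_append, List.nil_append] using this
      · have := Recurrent.append hk.recurrent h3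
        convert this using 1
        rw [← Set.union_assoc]
        congr 1
        ext q
        simp only [Set.mem_union, Set.mem_iUnion, Nat.lt_succ_iff_lt_or_eq]
        constructor
        · rintro ⟨j, hj | rfl, hq⟩
          · exact Or.inr ⟨j, hj, hq⟩
          · exact Or.inl hq
        · rintro (hq | ⟨j, hj, hq⟩)
          · exact ⟨k, Or.inr rfl, hq⟩
          · exact ⟨j, Or.inl hj, hq⟩)
  choose qs hqs hder using fun n => (hf n).2
  refine ⟨f, qs, hf0, fun k => (hf k).1, fun k => ?_, ?_⟩
  · have := Derives.append_left (hder k) ((spineWord l k).map Sum.inr)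
    simpa only [spineWord_succ, List.map_append, List.append_assoc] using this
  have hmem : ∀ k q, q ∈ qs k ↔
      q ∈ (l k).label ∪ ((⋃ j, ⋃ _ : j < k, (l j).R) ∪ Q) := by
    intro k q
    rw [← hqs k]
    rfl
  ext q
  constructor
  · intro hq
    by_contra hcon
    simp only [spineInf, Set.mem_union, not_or, Set.mem_iUnion, not_exists,
      Set.mem_ofPred_eq, not_forall, not_and] at hcon
    obtain ⟨⟨⟨n, h1⟩, h2⟩, h3⟩ := hcon
    obtain ⟨k, hk, hq⟩ := hq n
    rcases (hmem k q).1 hq with h4 | h4 | h4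
    · exact h1 k hk h4
    · obtain ⟨j, -, h5⟩ := Set.mem_iUnion₂.1 h4
      exact h2 j h5
    · exact h3 h4
  · rintro ((hq | hq) | hq) n
    · obtain ⟨k, hk, hq⟩ := hq n
      exact ⟨k, hk, (hmem k q).2 (Or.inl hq)⟩
    · obtain ⟨j, hq⟩ := Set.mem_iUnion.1 hq
      exact ⟨n + j + 1, by omega, (hmem _ q).2 (Or.inr (Or.inl
        (Set.mem_iUnion₂.2 ⟨j, by omega, hq⟩)))⟩
    · exact ⟨n, le_rfl, (hmem _ q).2 (Or.inr (Or.inr hq))⟩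

/-- A path can be turned back into a derivation, with a recurrent sentential form behind it. -/
theorem mem_lang_of_isSpine {ρ : AccRho} {u : ℕ → T} {l : ℕ → Level G} (hl : IsSpine l)
    {ps : List G.P} {w : List T} {r : List (G.N ⊕ T)} {Q : Set G.P}
    (hd : G.Derives ps [Sum.inl G.start] (w.map Sum.inr ++ Sum.inl (l 0).Y :: r))
    (hr : Recurrent G.Step Q r) (hgrow : ∀ n, ∃ k, n ≤ (spineWord l k).length)
    (hu : ∀ k, MatchesPrefix (w ++ spineWord l k) u)
    (hacc : ∃ F ∈ G.acc, rhoRel ρ (spineInf l ∪ Q) F) : u ∈ G.Lang .inf ρ .nl := by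
  obtain ⟨f, qs, hf0, -, hder, hset⟩ := hl.exists_blocks hr
  let x : ℕ → List (G.N ⊕ T) := fun n => match n with
    | 0 => [Sum.inl G.start]
    | k + 1 => (w ++ spineWord l k).map Sum.inr ++ Sum.inl (l k).Y :: f k
  let bs : ℕ → List G.P := fun n => match n with
    | 0 => ps
    | k + 1 => qs k
  refine mem_lang_of_blocks (x := x) (ps := bs) rfl ?_ ?_ ?_ ?_
  · rintro (_ | k)
    · simp only [x, bs, hf0, spineWord_zero, List.append_nil]
      exact hd
    · have := Derives.append_left (hder k) (w.map Sum.inr)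
      simp only [x, bs, List.map_append, List.append_assoc] at this ⊢
      exact this
  · intro n
    obtain ⟨k, hk⟩ := hgrow n
    refine ⟨k + 1, ?_⟩
    simp only [x, termPrefix_map_inr_append, List.length_append]
    omega
  · rintro (_ | k)
    · exact MatchesPrefix.nil u
    · simpa only [x, termPrefix_map_inr_append, termPrefix_inl_cons, List.append_nil] using hu k
  · have : {q | ∀ n : ℕ, ∃ m, n ≤ m ∧ q ∈ bs m} = {q | ∀ n : ℕ, ∃ m, n ≤ m ∧ q ∈ qs m} := by
      ext q
      constructor
      · intro hq n
        obtain ⟨m, hm, hq⟩ := hq (n + 1)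
        obtain ⟨k, rfl⟩ : ∃ k, m = k + 1 := ⟨m - 1, by omega⟩
        exact ⟨k, by omega, hq⟩
      · intro hq n
        obtain ⟨m, hm, hq⟩ := hq n
        exact ⟨m + 1, by omega, hq⟩
    rwa [this, hset]

/-- A sentential form on a path can be developed until exactly the productions used infinitely
often recur. -/
theorem IsSpine.exists_recurrent {l : ℕ → Level G} (hl : IsSpine l) {r : List (G.N ⊕ T)}
    {Q : Set G.P} (hr : Recurrent G.Step Q r) :
    ∃ vs y, G.Derives vs (Sum.inl (l 0).Y :: r) y ∧ Recurrent G.Step (spineInf l ∪ Q) y := by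
  obtain ⟨f, qs, hf0, -, hder, hset⟩ := hl.exists_blocks hr
  obtain ⟨y, o, hy0, hrun, -, -, hinf⟩ := exists_run_of_blocks hder
  obtain ⟨vs, z, h1, h2, -⟩ := hrun.exists_recurrent
  rw [hinf, hset] at h2
  refine ⟨vs, z, ?_, h2⟩
  rw [hy0, hf0] at h1
  exact h1

/-- The sentential forms on a path are derivable. -/
theorem IsSpine.exists_derives {l : ℕ → Level G} (hl : IsSpine l) (k : ℕ) :
    ∃ ps r, G.Derives ps [Sum.inl (l 0).Y]
        ((spineWord l k).map Sum.inr ++ Sum.inl (l k).Y :: r) ∧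
      Recurrent G.Step (⋃ j, ⋃ _ : j < k, (l j).R) r := by
  obtain ⟨f, qs, hf0, hrec, hder, -⟩ := hl.exists_blocks (Recurrent.empty [])
  have : ∀ k, ∃ ps, G.Derives ps [Sum.inl (l 0).Y]
      ((spineWord l k).map Sum.inr ++ Sum.inl (l k).Y :: f k) := by
    intro k
    induction k with
    | zero => exact ⟨[], by simpa [hf0] using Der.nil _⟩
    | succ k ih =>
      obtain ⟨ps, h⟩ := ih
      exact ⟨_, Der.append h (hder k)⟩
  obtain ⟨ps, h⟩ := this k
  exact ⟨ps, f k, h, by simpa using hrec k⟩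

theorem IsSpine.shift {l : ℕ → Level G} (hl : IsSpine l) (k : ℕ) :
    IsSpine fun j => l (k + j) := fun j => hl (k + j)

theorem spineInf_shift_union (l : ℕ → Level G) (k : ℕ) :
    spineInf (fun j => l (k + j)) ∪ ⋃ j, ⋃ _ : j < k, (l j).R = spineInf l := by
  ext q
  simp only [spineInf, Set.mem_union, Set.mem_iUnion, Set.mem_ofPred_eq, or_assoc]
  refine or_congr ?_ ?_
  · constructor
    · intro h n
      obtain ⟨m, hm, h⟩ := h n
      exact ⟨k + m, by omega, h⟩
    · intro h n
      obtain ⟨m, hm, h⟩ := h (k + n)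
      exact ⟨m - k, by omega, by rwa [Nat.add_sub_cancel' (by omega)]⟩
  · constructor
    · rintro (⟨j, hj⟩ | ⟨j, -, hj⟩)
      · exact ⟨_, hj⟩
      · exact ⟨_, hj⟩
    · rintro ⟨j, hj⟩
      rcases Nat.lt_or_ge j k with h | h
      · exact Or.inr ⟨j, h, hj⟩
      · exact Or.inl ⟨j - k, by rwa [Nat.add_sub_cancel' h]⟩

/-- From some level on, only productions used infinitely often occur. -/
theorem exists_forall_label_subset_spineInf (l : ℕ → Level G) :
    ∃ K, ∀ k, K ≤ k → (l k).label ⊆ spineInf l := by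
  have := G.fintypeP
  have : ∀ q : G.P, ∃ K, ∀ k, K ≤ k → q ∈ (l k).label → q ∈ spineInf l := by
    intro q
    by_cases hq : ∀ n : ℕ, ∃ k, n ≤ k ∧ q ∈ (l k).label
    · exact ⟨0, fun _ _ _ => Or.inl hq⟩
    · push Not at hq
      obtain ⟨K, hK⟩ := hq
      exact ⟨K, fun k hk h => absurd h (hK k hk)⟩
  choose K hK using this
  exact ⟨Finset.univ.sup K, fun k hk q hq =>
    hK q k ((Finset.le_sup (Finset.mem_univ q)).trans hk) hq⟩

end OmegaPSG

/-- For finitely many `e`, the values met infinitely often are the values of those `e` that are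
met infinitely often. -/
theorem biUnion_infinitely_often {E P : Type*} [Finite E] (b : ℕ → List E) (lab : E → Set P) :
    ⋃ e ∈ {e | ∀ n : ℕ, ∃ m, n ≤ m ∧ e ∈ b m}, lab e =
      {q | ∀ n : ℕ, ∃ m, n ≤ m ∧ ∃ e ∈ b m, q ∈ lab e} := by
  have := Fintype.ofFinite E
  ext q
  constructor
  · intro hq n
    obtain ⟨e, he, hq⟩ := Set.mem_iUnion₂.1 hq
    obtain ⟨m, hm, he⟩ := he n
    exact ⟨m, hm, e, he, hq⟩
  · intro hq
    by_contra hcon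
    have : ∀ e, ∃ n : ℕ, q ∈ lab e → ∀ m, n ≤ m → e ∉ b m := by
      intro e
      by_cases he : q ∈ lab e
      · by_contra h1
        push Not at h1
        exact hcon (Set.mem_iUnion₂.2 ⟨e, fun n => (h1 n).2, he⟩)
      · exact ⟨0, fun h => absurd h he⟩
    choose n hn using this
    obtain ⟨m, hm, e, he, hqe⟩ := hq (Finset.univ.sup n)
    exact hn e hqe m ((Finset.le_sup (Finset.mem_univ e)).trans hm) he

namespace OmegaPSG

variable {T : Type} {G : OmegaPSG T}

/-- A terminal word can be derived leftmost, using the same productions. -/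
theorem Derives.exists_leftmost (hG : G.IsCFG) (n : ℕ) {ps : List G.P} {α : List (G.N ⊕ T)}
    {w : List T} (hn : ps.length ≤ n) (h : G.Derives ps α (w.map Sum.inr)) :
    ∃ ls, Der G.LStep ls α (w.map Sum.inr) ∧ ∀ q, q ∈ ls ↔ q ∈ ps := by
  induction n generalizing ps α w with
  | zero =>
    obtain rfl : ps = [] := List.eq_nil_of_length_eq_zero (by omega)
    exact ⟨[], h.eq_of_nil ▸ .nil _, by simp⟩
  | succ n ihn =>
    induction α generalizing ps w with
    | nil =>
      obtain ⟨rfl, h1⟩ := Derives.eq_of_map_inr hG (w := []) h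
      exact ⟨[], h1 ▸ .nil _, by simp⟩
    | cons s α ih =>
      obtain ⟨ps₁, ps₂, z₁, z₂, h1, h2, h3, h4, h5⟩ := Derives.split hG (a := [s]) h
      obtain ⟨w₁, w₂, rfl, rfl, rfl⟩ := exists_of_append_eq_map_inr h1.symm
      obtain ⟨ls₂, h6, h7⟩ := ih (by omega) h3
      obtain ⟨ls₁, h8, h9⟩ : ∃ ls, Der G.LStep ls [s] (w₁.map Sum.inr) ∧
          ∀ q, q ∈ ls ↔ q ∈ ps₁ := by
        cases s with
        | inr a =>
          obtain ⟨rfl, h8⟩ := Derives.eq_of_map_inr hG (w := [a]) h2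
          exact ⟨[], h8 ▸ .nil _, by simp⟩
        | inl X =>
          obtain ⟨p, ps', rfl, h8, h9⟩ := Derives.of_singleton hG h2
          simp only [List.length_cons] at h5
          obtain ⟨ls, h10, h11⟩ := ihn (by omega) h9
          refine ⟨p :: ls, .cons ⟨[], [], by simp, by simp [h8], rfl⟩ (by simpa using h10), ?_⟩
          intro q
          simp [h11]
      refine ⟨ls₁ ++ ls₂, ?_, fun q => by rw [h4, List.mem_append, h9, h7]⟩
      have h10 := h8.map (R' := G.LStep) id (fun z => z ++ α) fun _ _ _ hs => by
        simpa using hs.append [] α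
      have h11 := h6.map (R' := G.LStep) id (fun z => w₁.map Sum.inr ++ z) fun _ _ _ hs => by
        simpa using hs.append w₁ []
      simpa using h10.append h11

/-- The productions of the leftmost grammar that follow the infinite path: `p` rewrites `Y`, the
path continues with the symbol `Z` at position `i`, the rest is only recorded by the set `V` of
productions used finitely often in it and the set `R` of those used infinitely often; `Q` records
the productions used infinitely often so far. -/
structure SpineProd (G : OmegaPSG T) where
  p : G.P
  i : Fin ((G.rhs p).length + 1)
  Y : G.N
  Z : G.N
  V : Set G.P
  Q : Set G.P
  R : Set G.P
  lhs : G.lhs p = [Y]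
  rhs : G.rhs p = (G.rhs p).take i ++ Sum.inl Z :: (G.rhs p).drop (i + 1)
  tail : ∃ vs δ', {q | q ∈ vs} = V ∧ G.Derives vs ((G.rhs p).drop (i + 1)) δ' ∧
    Recurrent G.Step R δ'

instance (G : OmegaPSG T) : Finite (SpineProd G) := by
  refine Finite.of_injective (β := (Σ p : G.P, Fin ((G.rhs p).length + 1)) × G.N × G.N ×
    Set G.P × Set G.P × Set G.P) (fun t => (⟨t.p, t.i⟩, t.Y, t.Z, t.V, t.Q, t.R)) ?_
  rintro ⟨p, i, Y, Z, V, Q, R, _, _, _⟩ ⟨p', i', Y', Z', V', Q', R', _, _, _⟩ h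
  simp only [Prod.mk.injEq, Sigma.mk.injEq] at h
  obtain ⟨⟨rfl, h⟩, rfl, rfl, rfl, rfl, rfl⟩ := h
  obtain rfl := eq_of_heq h
  rfl

/-- Ordinary symbols as symbols of the leftmost grammar. -/
def leftEmb (G : OmegaPSG T) : G.N ⊕ T → (G.N ⊕ G.N × Set G.P) ⊕ T := Sum.map Sum.inl id

/-- The productions of `G` that a production of the leftmost grammar stands for. -/
def leftLabel (G : OmegaPSG T) : G.P ⊕ SpineProd G → Set G.P
  | .inl p => {p}
  | .inr t => insert t.p (t.V ∪ t.Q)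

/-- A grammar generating by leftmost derivations what `G` generates by arbitrary ones. -/
noncomputable abbrev leftGrammar (G : OmegaPSG T) (ρ : AccRho) : OmegaPSG T :=
  { N := G.N ⊕ G.N × Set G.P
    fintypeN := Fintype.ofFinite _
    P := G.P ⊕ SpineProd G
    fintypeP := Fintype.ofFinite _
    lhs := Sum.elim (fun p => (G.lhs p).map Sum.inl) fun t => [Sum.inr (t.Y, t.Q)]
    lhs_ne := by
      rintro (p | t)
      · simpa using G.lhs_ne p
      · simp
    rhs := Sum.elim (fun p => (G.rhs p).map (leftEmb G)) fun t =>
      ((G.rhs t.p).take t.i).map (leftEmb G) ++ [Sum.inl (Sum.inr (t.Z, t.Q ∪ t.R))]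
    start := Sum.inr (G.start, ∅)
    acc := {E | ∃ F ∈ G.acc, (ρ = .cap → E = {e | (leftLabel G e ∩ F).Nonempty}) ∧
      (ρ = .eq → ⋃ e ∈ E, leftLabel G e = F)} }

theorem leftGrammar_acc {ρ : AccRho} (hρ : ρ = .cap ∨ ρ = .eq) (I : Set (G.P ⊕ SpineProd G)) :
    (∃ E ∈ (leftGrammar G ρ).acc, rhoRel ρ I E) ↔
      ∃ F ∈ G.acc, rhoRel ρ (⋃ e ∈ I, leftLabel G e) F := by
  rcases hρ with rfl | rfl
  · constructor
    · rintro ⟨E, ⟨F, hF, h1, -⟩, e, he, hE⟩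
      rw [h1 rfl] at hE
      obtain ⟨q, hq, hqF⟩ := hE
      exact ⟨F, hF, q, Set.mem_iUnion₂.2 ⟨e, he, hq⟩, hqF⟩
    · rintro ⟨F, hF, q, hq, hqF⟩
      obtain ⟨e, he, hq⟩ := Set.mem_iUnion₂.1 hq
      exact ⟨_, ⟨F, hF, fun _ => rfl, by simp⟩, e, he, q, hq, hqF⟩
  · constructor
    · rintro ⟨E, ⟨F, hF, -, h1⟩, rfl⟩
      exact ⟨F, hF, h1 rfl⟩
    · rintro ⟨F, hF, h1⟩
      exact ⟨I, ⟨F, hF, by simp, fun _ => h1⟩, rfl⟩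

theorem isCFG_leftGrammar (hG : G.IsCFG) (ρ : AccRho) : (leftGrammar G ρ).IsCFG := by
  rintro (p | t)
  · simpa [leftGrammar] using hG p
  · simp [leftGrammar]

theorem termPrefix_map_leftEmb_append (x z : List (G.N ⊕ T)) (A : G.N ⊕ G.N × Set G.P) (B : G.N)
    (z' : List ((G.N ⊕ G.N × Set G.P) ⊕ T)) :
    termPrefix (x.map (leftEmb G) ++ Sum.inl A :: z') = termPrefix (x ++ Sum.inl B :: z) := by
  induction x with
  | nil => simp
  | cons s x ih =>
    cases s with
    | inl C => simp [leftEmb]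
    | inr a => simpa [leftEmb, termPrefix] using ih

theorem map_leftEmb_map_inr (w : List T) :
    (w.map Sum.inr : List (G.N ⊕ T)).map (leftEmb G) = w.map Sum.inr := by
  simp [leftEmb, Function.comp_def]

theorem LStep.leftGrammar {p : G.P} {x y : List (G.N ⊕ T)} (h : G.LStep p x y) (ρ : AccRho) :
    (leftGrammar G ρ).LStep (Sum.inl p) (x.map (leftEmb G)) (y.map (leftEmb G)) := by
  obtain ⟨u, v, hu, rfl, rfl⟩ := h
  refine ⟨u.map (leftEmb G), v.map (leftEmb G), ?_, ?_, ?_⟩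
  · intro s hs
    obtain ⟨s', hs', rfl⟩ := List.mem_map.1 hs
    obtain ⟨a, rfl⟩ := hu s' hs'
    exact ⟨a, rfl⟩
  · simp only [List.map_append, OmegaPSG.leftGrammar, Sum.elim_inl, List.map_map]
    rfl
  · rw [List.map_append, List.map_append]
    rfl

theorem lang_subset_lang_leftGrammar (hG : G.IsCFG) {ρ : AccRho} (hρ : ρ = .cap ∨ ρ = .eq) :
    G.Lang .inf ρ .nl ⊆ (leftGrammar G ρ).Lang .inf ρ .l := by
  intro u hu
  obtain ⟨l, hl, h0, hgrow, hmat, hacc⟩ := exists_isSpine_of_mem_lang hG hu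
  choose ls hls hmem using fun k => (hl k).der.exists_leftmost hG _ le_rfl
  let Q : ℕ → Set G.P := fun k => ⋃ j, ⋃ _ : j < k, (l j).R
  have htake : ∀ k, (G.rhs (l k).p).take (l k).α.length = (l k).α := fun k => by
    rw [(hl k).rhs]; simp
  have hdrop : ∀ k, (G.rhs (l k).p).drop ((l k).α.length + 1) = (l k).δ := fun k => by
    rw [(hl k).rhs]; simp
  let t : ℕ → SpineProd G := fun k =>
    { p := (l k).p
      i := ⟨(l k).α.length, by rw [(hl k).rhs]; simp⟩
      Y := (l k).Y
      Z := (l (k + 1)).Y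
      V := {q | q ∈ (l k).vs}
      Q := Q k
      R := (l k).R
      lhs := (hl k).lhs
      rhs := by
        simp only
        rw [htake, hdrop]
        exact (hl k).rhs
      tail := by
        refine ⟨(l k).vs, (l k).δ', rfl, ?_, (hl k).recurrent⟩
        simp only
        rw [hdrop]
        exact (hl k).tail }
  have hQ : ∀ k, Q (k + 1) = Q k ∪ (l k).R := by
    intro k
    ext q
    simp only [Q, Set.mem_union, Set.mem_iUnion, Nat.lt_succ_iff_lt_or_eq]
    constructor
    · rintro ⟨j, hj | rfl, hq⟩
      · exact Or.inl ⟨j, hj, hq⟩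
      · exact Or.inr hq
    · rintro (⟨j, hj, hq⟩ | hq)
      · exact ⟨j, Or.inl hj, hq⟩
      · exact ⟨k, Or.inr rfl, hq⟩
  let b : ℕ → List (G.P ⊕ SpineProd G) := fun k => Sum.inr (t k) :: (ls k).map Sum.inl
  have hlab : ∀ k q, (∃ e ∈ b k, q ∈ leftLabel G e) ↔ q ∈ (l k).label ∪ Q k := by
    intro k q
    constructor
    · rintro ⟨e, he, hq⟩
      rcases List.mem_cons.1 he with rfl | he
      · rcases hq with rfl | hq | hq
        · exact Or.inl (Or.inl rfl)
        · exact Or.inl (Or.inr (Or.inr hq))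
        · exact Or.inr hq
      · obtain ⟨q', hq', rfl⟩ := List.mem_map.1 he
        obtain rfl : q = q' := hq
        exact Or.inl (Or.inr (Or.inl ((hmem k q).1 hq')))
    · rintro ((rfl | hq | hq) | hq)
      · exact ⟨_, List.mem_cons_self .., Or.inl rfl⟩
      · exact ⟨Sum.inl q, List.mem_cons_of_mem _ (List.mem_map_of_mem ((hmem k q).2 hq)), rfl⟩
      · exact ⟨_, List.mem_cons_self .., Or.inr (Or.inl hq)⟩
      · exact ⟨_, List.mem_cons_self .., Or.inr (Or.inr hq)⟩
  refine mem_lang_of_blocks (G := leftGrammar G ρ) (π := .l) (ps := b)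
    (x := fun k => (spineWord l k).map Sum.inr ++ [Sum.inl (Sum.inr ((l k).Y, Q k))]) ?_ ?_ ?_ ?_ ?_
  · simp [leftGrammar, Q, h0]
  · intro k
    refine .cons (y := (spineWord l k).map Sum.inr ++ (l k).α.map (leftEmb G) ++
      [Sum.inl (Sum.inr ((l (k + 1)).Y, Q (k + 1)))]) ?_ ?_
    · refine ⟨(spineWord l k).map Sum.inr, [], by simp, ?_, ?_⟩
      · exact (List.append_nil _).symm
      · simp only [leftGrammar, t, Sum.elim_inr, htake, hQ, List.append_assoc]
        rw [List.append_nil]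
    · have h1 := (hls k).map (R' := (leftGrammar G ρ).LStep) Sum.inl (List.map (leftEmb G))
        fun _ _ _ hs => hs.leftGrammar ρ
      rw [map_leftEmb_map_inr] at h1
      have h2 := h1.map (R' := (leftGrammar G ρ).LStep) id
        (fun z : List ((G.leftGrammar ρ).N ⊕ T) => (spineWord l k).map Sum.inr ++ z ++
          ([Sum.inl (Sum.inr ((l (k + 1)).Y, Q (k + 1)))] : List ((G.leftGrammar ρ).N ⊕ T)))
        fun _ _ _ hs => hs.append _ _
      rw [List.map_id] at h2
      simp only [spineWord_succ, List.map_append]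
      exact h2
  · intro n
    obtain ⟨k, hk⟩ := hgrow n
    exact ⟨k, by simpa using hk⟩
  · intro k
    simpa using hmat k
  · refine (leftGrammar_acc hρ _).2 ?_
    have := biUnion_infinitely_often b (leftLabel G)
    rw [this]
    have h2 : {q | ∀ n : ℕ, ∃ m, n ≤ m ∧ ∃ e ∈ b m, q ∈ leftLabel G e} = spineInf l := by
      simp only [hlab]
      ext q
      constructor
      · intro hq
        by_contra hcon
        simp only [spineInf, Set.mem_union, not_or, Set.mem_iUnion, not_exists,
          Set.mem_ofPred_eq, not_forall, not_and] at hcon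
        obtain ⟨⟨n, h1⟩, h2⟩ := hcon
        obtain ⟨m, hm, h4 | h4⟩ := hq n
        · exact h1 m hm h4
        · obtain ⟨j, -, h5⟩ := Set.mem_iUnion₂.1 h4
          exact h2 j h5
      · rintro (hq | hq) n
        · obtain ⟨k, hk, hq⟩ := hq n
          exact ⟨k, hk, Or.inl hq⟩
        · obtain ⟨j, hq⟩ := Set.mem_iUnion.1 hq
          exact ⟨n + j + 1, by omega, Or.inr (Set.mem_iUnion₂.2 ⟨j, by omega, hq⟩)⟩
    rwa [h2]

theorem Step.of_leftGrammar (hG : G.IsCFG) {ρ : AccRho} {e : G.P ⊕ SpineProd G}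
    {x : List (G.N ⊕ T)} {y : List ((G.N ⊕ G.N × Set G.P) ⊕ T)}
    (h : (leftGrammar G ρ).Step e (x.map (leftEmb G)) y) :
    ∃ p x', e = Sum.inl p ∧ y = x'.map (leftEmb G) ∧ G.Step p x x' := by
  obtain ⟨u, v, h1, rfl⟩ := h
  obtain ⟨x₁, x₃, rfl, h2, rfl⟩ := List.map_eq_append_iff.1 h1
  obtain ⟨x₁, x₂, rfl, rfl, h3⟩ := List.map_eq_append_iff.1 h2
  cases e with
  | inl p =>
    obtain ⟨A, hA⟩ := exists_lhs_eq hG p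
    refine ⟨p, x₁ ++ G.rhs p ++ x₃, rfl, by simp [leftGrammar], x₁, x₃, ?_, rfl⟩
    have h4 : (x₂.map (leftEmb G)) = ((G.lhs p).map Sum.inl).map (leftEmb G) := by
      rw [h3]
      simp only [leftGrammar, Sum.elim_inl, List.map_map]
      rfl
    have h5 : Function.Injective (leftEmb G) :=
      Sum.map_injective.2 ⟨Sum.inl_injective, Function.injective_id⟩
    rw [List.map_injective_iff.2 h5 h4]
  | inr t =>
    exfalso
    have : (Sum.inl (Sum.inr (t.Y, t.Q)) : (G.N ⊕ G.N × Set G.P) ⊕ T) ∈ x₂.map (leftEmb G) := by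
      rw [h3]
      simp [leftGrammar]
    obtain ⟨s, -, hs⟩ := List.mem_map.1 this
    rcases s with s | s <;> simp [leftEmb] at hs

theorem lang_leftGrammar_subset_lang (hG : G.IsCFG) {ρ : AccRho} (hρ : ρ = .cap ∨ ρ = .eq) :
    (leftGrammar G ρ).Lang .inf ρ .l ⊆ G.Lang .inf ρ .nl := by
  rintro u ⟨s, d, hs0, hs, hunb, hmat, hacc⟩
  obtain ⟨f, hf0, hf⟩ := exists_seq
    (S := List (G.N ⊕ T) × G.N × Set G.P × List (G.N ⊕ T))
    (Inv := fun n c => s n = c.1.map (leftEmb G) ++ [Sum.inl (Sum.inr (c.2.1, c.2.2.1))] ∧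
      Recurrent G.Step c.2.2.1 c.2.2.2)
    (Rel := fun n c c' => ∃ qs : List G.P, {q | q ∈ qs} = leftLabel G (d n) ∧
      G.Derives qs (c.1 ++ Sum.inl c.2.1 :: c.2.2.2) (c'.1 ++ Sum.inl c'.2.1 :: c'.2.2.2))
    (s₀ := ([], G.start, ∅, [])) ⟨hs0, Recurrent.empty _⟩ (by
      rintro n ⟨x, Y, Q, r⟩ ⟨h1, h2⟩
      have h3 : (leftGrammar G ρ).Step (d n) (s n) (s (n + 1)) := LStep.step (hs n)
      simp only at h1 h2
      rw [h1] at h3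
      rcases Step.split (isCFG_leftGrammar hG ρ) h3 with ⟨x', h4, h5⟩ | ⟨y, h4, h5⟩
      · obtain ⟨p, x', hp, rfl, h6⟩ := Step.of_leftGrammar hG h4
        refine ⟨(x', Y, Q, r), ⟨[p], ?_, ?_⟩, h5, h2⟩
        · rw [hp]
          ext q
          simp [leftLabel]
        · exact Derives.append_right (.single h6) _
      · obtain ⟨h6, rfl⟩ := step_singleton (isCFG_leftGrammar hG ρ) h4
        cases hd : d n with
        | inl p =>
          exfalso
          rw [hd] at h6
          obtain ⟨A, hA⟩ := exists_lhs_eq hG p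
          simp [leftGrammar, hA] at h6
        | inr t =>
          rw [hd] at h6 h5
          simp only [leftGrammar, Sum.elim_inr, List.cons.injEq, Sum.inr.injEq, Prod.mk.injEq,
            and_true] at h6
          obtain ⟨rfl, rfl⟩ := h6
          obtain ⟨vs, δ', h7, h8, h9⟩ := t.tail
          obtain ⟨rs, r', h10, h11, h12⟩ := h2.next
          refine ⟨(x ++ (G.rhs t.p).take t.i, t.Z, t.Q ∪ t.R, δ' ++ r'),
            ⟨t.p :: (vs ++ rs), ?_, ?_⟩, ?_, ?_⟩
          · simp only [leftLabel, ← h7, ← h10]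
            ext q
            simp
          · refine .cons (y := x ++ ((G.rhs t.p).take t.i ++ Sum.inl t.Z ::
              (G.rhs t.p).drop (t.i + 1)) ++ r) ?_ ?_
            · have h13 := (step_of_lhs_eq t.lhs).append x r
              have h14 := congrArg (fun z => x ++ z ++ r) t.rhs
              rw [← h14]
              simpa only [List.append_assoc, List.cons_append, List.nil_append] using h13
            · refine Der.append (y := x ++ (G.rhs t.p).take t.i ++ Sum.inl t.Z :: (δ' ++ r)) ?_ ?_
              · have := Derives.append h8 (x ++ (G.rhs t.p).take t.i ++ [Sum.inl t.Z]) r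
                simpa only [List.append_assoc, List.cons_append, List.nil_append] using this
              · have := Derives.append_left h11
                  (x ++ (G.rhs t.p).take t.i ++ Sum.inl t.Z :: δ')
                simpa only [List.append_assoc, List.cons_append, List.nil_append] using this
          · rw [h5]
            simp [leftGrammar]
          · rw [Set.union_comm]
            exact Recurrent.append h9 h12)
  choose qs hqs hder using fun n => (hf n).2
  refine mem_lang_of_blocks (π := .nl) (ps := qs)
    (x := fun n => (f n).1 ++ Sum.inl (f n).2.1 :: (f n).2.2.2) (by simp [hf0]) hder ?_ ?_ ?_
  · intro n
    obtain ⟨i, hi⟩ := hunb n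
    rw [(hf i).1.1, termPrefix_map_leftEmb_append] at hi
    exact ⟨i, hi⟩
  · intro i
    have := hmat i
    rwa [(hf i).1.1, termPrefix_map_leftEmb_append] at this
  · obtain ⟨F, hF, h1⟩ := (leftGrammar_acc hρ _).1 hacc
    refine ⟨F, hF, ?_⟩
    have h2 := biUnion_infinitely_often (fun n => [d n]) (leftLabel G)
    have h3 : sigmaSet .inf d = {e | ∀ n : ℕ, ∃ m, n ≤ m ∧ e ∈ [d m]} := by
      ext e
      simp [sigmaSet, eq_comm]
    rw [h3, h2] at h1
    convert h1 using 1
    ext q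
    have h4 : ∀ m, q ∈ qs m ↔ q ∈ leftLabel G (d m) := fun m => by rw [← hqs m]; rfl
    simp [h4]

end OmegaPSG

/-- Leftmost derivations are at least as powerful as arbitrary ones. -/
theorem gLang_nl_subset_gLang_l (T : Type) {ρ : AccRho} (hρ : ρ = .cap ∨ ρ = .eq) :
    GLang T OmegaPSG.IsCFG .inf ρ .nl ⊆ GLang T OmegaPSG.IsCFG .inf ρ .l := by
  rintro _ ⟨G, hG, rfl⟩
  exact ⟨G.leftGrammar ρ, OmegaPSG.isCFG_leftGrammar hG ρ,
    (OmegaPSG.lang_subset_lang_leftGrammar hG hρ).antisymm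
      (OmegaPSG.lang_leftGrammar_subset_lang hG hρ)⟩

section Limit

variable {T : Type*}

/-- A sequence of words, each a prefix of the next and growing beyond every bound, has a limit. -/
theorem exists_limit_word (x : ℕ → List T) (hx : ∀ i, x i <+: x (i + 1))
    (hunb : ∀ n : ℕ, ∃ i, n ≤ (x i).length) : ∃ u : ℕ → T, ∀ i, MatchesPrefix (x i) u := by
  have hmono : ∀ i j, x i <+: x (i + j) := by
    intro i j
    induction j with
    | zero => exact List.prefix_rfl
    | succ j ih => exact ih.trans (hx _)
  choose f hf using fun n => hunb (n + 1)
  refine ⟨fun n => (x (f n))[n]'(hf n), fun i k hk => ?_⟩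
  simp only [List.get_eq_getElem]
  rcases Nat.le_total i (f k) with h | h
  · have := hmono i (f k - i)
    rw [Nat.add_sub_cancel' h] at this
    exact this.getElem hk
  · have := hmono (f k) (i - f k)
    rw [Nat.add_sub_cancel' h] at this
    exact (this.getElem (hf k)).symm

theorem MatchesPrefix.map_range {l : List T} {n : ℕ → T} (h : MatchesPrefix l n) {i : ℕ}
    (hi : i ≤ l.length) : (List.range i).map n <+: l := by
  have : (List.range i).map n = l.take i := by
    refine List.ext_getElem (by simpa using hi) fun k h1 h2 => ?_
    simp only [List.length_map, List.length_range] at h1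
    simpa using (h k (by omega)).symm
  rw [this]
  exact ⟨_, List.take_append_drop i l⟩

end Limit

/-- The word `aⁿbⁿ`. -/
def abBlock (n : ℕ) : List Bool := List.replicate n false ++ List.replicate n true

/-- The concatenation of the words `aⁿbⁿ` for the entries `n` of a list. -/
def abWord (ns : List ℕ) : List Bool := ns.flatMap abBlock

theorem abWord_append (ns ms : List ℕ) : abWord (ns ++ ms) = abWord ns ++ abWord ms := by
  simp [abWord]

theorem abWord_singleton (n : ℕ) : abWord [n] = abBlock n := by simp [abWord]

theorem abWord_isPrefix {ns ms : List ℕ} (h : ns <+: ms) : abWord ns <+: abWord ms := by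
  obtain ⟨t, rfl⟩ := h
  rw [abWord_append]
  exact List.prefix_append _ _

theorem abWord_range_succ (n : ℕ → ℕ) (i : ℕ) :
    abWord ((List.range (i + 1)).map n) = abWord ((List.range i).map n) ++ abBlock (n i) := by
  rw [List.range_succ, List.map_append, abWord_append, ← abWord_singleton]
  rfl

theorem length_abWord_range (n : ℕ → ℕ) (i : ℕ) :
    (abWord ((List.range i).map n)).length = ∑ j ∈ Finset.range i, 2 * n j := by
  induction i with
  | zero => rfl
  | succ i ih =>
    rw [abWord_range_succ, List.length_append, ih, Finset.sum_range_succ, abBlock]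
    simp
    omega

theorem le_length_abWord_range {n : ℕ → ℕ} (hn : ∀ i, 1 ≤ n i) (i : ℕ) :
    i ≤ (abWord ((List.range i).map n)).length := by
  induction i with
  | zero => simp
  | succ i ih =>
    rw [abWord_range_succ, List.length_append, abBlock]
    have := hn i
    simp
    omega

theorem matchesPrefix_abBlock {n : ℕ} {v : ℕ → Bool} :
    MatchesPrefix (abBlock n) v ↔ ∀ k, k < 2 * n → v k = decide (n ≤ k) := by
  have hlen : (abBlock n).length = 2 * n := by simp [abBlock]; omega
  have hget : ∀ k (hk : k < (abBlock n).length), (abBlock n).get ⟨k, hk⟩ = decide (n ≤ k) := by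
    intro k hk
    simp only [abBlock, List.get_eq_getElem, List.getElem_append, List.length_replicate,
      List.getElem_replicate]
    split_ifs with h
    · simp; omega
    · simp; omega
  constructor
  · intro h k hk
    rw [← hget k (by omega), h k (by omega)]
  · intro h k hk
    rw [hget, h k (by omega)]

theorem mem_abLang_iff {u : ℕ → Bool} :
    u ∈ abLang ↔ ∃ n : ℕ → ℕ, (∀ i, 1 ≤ n i) ∧
      ∀ i, MatchesPrefix (abWord ((List.range i).map n)) u := by
  refine exists_congr fun n => and_congr_right fun _ => ?_
  have key : ∀ i, (∀ k : ℕ, k < 2 * n i → u ((∑ j ∈ Finset.range i, 2 * n j) + k) =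
      decide (n i ≤ k)) ↔ MatchesPrefix (abBlock (n i)) fun k =>
        u ((abWord ((List.range i).map n)).length + k) := fun i => by
    rw [matchesPrefix_abBlock, length_abWord_range]
  constructor
  · intro h i
    induction i with
    | zero => exact .nil _
    | succ i ih =>
      rw [abWord_range_succ, matchesPrefix_append]
      exact ⟨ih, (key i).1 (h i)⟩
  · intro h i
    have := h (i + 1)
    rw [abWord_range_succ, matchesPrefix_append] at this
    exact (key i).2 this.2

/-- Every sequence of block lengths is realized. -/
theorem exists_matchesPrefix_abWord {n : ℕ → ℕ} (hn : ∀ i, 1 ≤ n i) :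
    ∃ u, ∀ i, MatchesPrefix (abWord ((List.range i).map n)) u := by
  refine exists_limit_word _ (fun i => ?_) fun i => ⟨i, le_length_abWord_range hn i⟩
  rw [abWord_range_succ]
  exact List.prefix_append _ _

/-- The productions `S → AS`, `A → aAb`, `A → ab`. -/
inductive AbProd | split | wrap | base
deriving DecidableEq

instance : Fintype AbProd := ⟨{.split, .wrap, .base}, by rintro (_ | _ | _) <;> simp⟩

/-- A grammar for `{aⁿbⁿ | n ≥ 1}^ω`; the nonterminal `S` is `true`, `A` is `false`. -/
abbrev abGrammar (ρ : AccRho) : OmegaPSG Bool where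
  N := Bool
  P := AbProd
  lhs
    | .split => [true]
    | .wrap => [false]
    | .base => [false]
  lhs_ne := by rintro (_ | _ | _) <;> simp
  rhs
    | .split => [Sum.inl false, Sum.inl true]
    | .wrap => [Sum.inr false, Sum.inl false, Sum.inr true]
    | .base => [Sum.inr false, Sum.inr true]
  start := true
  acc := {E | AbProd.split ∈ E ∧ (ρ = .cap → E = {AbProd.split})}

theorem abGrammar_acc {ρ : AccRho} (hρ : ρ = .cap ∨ ρ = .eq) (I : Set AbProd) :
    (∃ F ∈ (abGrammar ρ).acc, rhoRel ρ I F) ↔ AbProd.split ∈ I := by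
  rcases hρ with rfl | rfl
  · constructor
    · rintro ⟨F, ⟨-, h⟩, q, hq, hqF⟩
      rw [h rfl] at hqF
      obtain rfl : q = _ := hqF
      exact hq
    · exact fun h => ⟨{AbProd.split}, ⟨rfl, fun _ => rfl⟩, _, h, rfl⟩
  · constructor
    · rintro ⟨F, ⟨h, -⟩, rfl⟩
      exact h
    · exact fun h => ⟨I, ⟨h, by simp⟩, rfl⟩

theorem isCFG_abGrammar (ρ : AccRho) : (abGrammar ρ).IsCFG := by
  rintro (_ | _ | _) <;> rfl

/-- `aⁱ A bⁱ`. -/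
def abCore (i : ℕ) : List (Bool ⊕ Bool) :=
  (List.replicate i false).map Sum.inr ++ Sum.inl false :: (List.replicate i true).map Sum.inr

theorem der_abCore (ρ : AccRho) (i : ℕ) :
    Der (abGrammar ρ).LStep (List.replicate i .wrap) [Sum.inl false] (abCore i) := by
  induction i with
  | zero => exact .nil _
  | succ i ih =>
    rw [List.replicate_succ']
    refine ih.append (.single ⟨(List.replicate i false).map Sum.inr,
      (List.replicate i true).map Sum.inr, by simp, by simp [abCore], ?_⟩)
    rw [abCore, List.replicate_succ', List.replicate_succ]
    simp

theorem der_abBlock (ρ : AccRho) {n : ℕ} (hn : 1 ≤ n) :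
    ∃ ps, Der (abGrammar ρ).LStep ps [Sum.inl false] ((abBlock n).map Sum.inr) := by
  obtain ⟨i, rfl⟩ := Nat.exists_eq_add_of_le' hn
  refine ⟨_, (der_abCore ρ i).append (.single (p := .base) ⟨(List.replicate i false).map Sum.inr,
      (List.replicate i true).map Sum.inr, by simp, by simp [abCore], ?_⟩)⟩
  rw [abBlock, List.replicate_succ', List.replicate_succ]
  simp

theorem abLang_subset_lang_abGrammar {ρ : AccRho} (hρ : ρ = .cap ∨ ρ = .eq) :
    abLang ⊆ (abGrammar ρ).Lang .inf ρ .l := by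
  intro u hu
  obtain ⟨n, hn, hu⟩ := mem_abLang_iff.1 hu
  choose ps hps using fun i => der_abBlock ρ (hn i)
  refine OmegaPSG.mem_lang_of_blocks (π := .l) (ps := fun i => .split :: ps i)
    (x := fun i => (abWord ((List.range i).map n)).map Sum.inr ++ [Sum.inl true]) rfl ?_ ?_ ?_ ?_
  · intro i
    refine .cons (y := (abWord ((List.range i).map n)).map Sum.inr ++ [Sum.inl false] ++
      [Sum.inl true]) ⟨(abWord ((List.range i).map n)).map Sum.inr, [], by simp, by simp,
        by simp⟩ ?_
    have h1 := (hps i).map (R' := (abGrammar ρ).LStep) id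
      (fun z => (abWord ((List.range i).map n)).map Sum.inr ++ z ++ [Sum.inl true])
      fun _ _ _ hs => hs.append _ _
    rw [List.map_id] at h1
    simp only [abWord_range_succ, List.map_append]
    exact h1
  · intro i
    exact ⟨i, by simpa using le_length_abWord_range hn i⟩
  · intro i
    simpa using hu i
  · exact (abGrammar_acc hρ _).2 fun n => ⟨n, le_rfl, List.mem_cons_self ..⟩

/-- A leftmost step rewrites the leftmost nonterminal. -/
theorem OmegaPSG.LStep.eq_of_inl {T : Type} {G : OmegaPSG T} (hG : G.IsCFG) {p : G.P} {w : List T}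
    {X : G.N} {r y : List (G.N ⊕ T)} (h : G.LStep p (w.map Sum.inr ++ Sum.inl X :: r) y) :
    G.lhs p = [X] ∧ y = w.map Sum.inr ++ G.rhs p ++ r := by
  obtain ⟨u, v, hu, h1, rfl⟩ := h
  obtain ⟨A, hA⟩ := OmegaPSG.exists_lhs_eq hG p
  obtain ⟨w', rfl⟩ : ∃ w' : List T, u = w'.map Sum.inr := by
    rcases terminal_or_exists_inl u with h | ⟨w', B, z, rfl⟩
    · exact h
    · obtain ⟨a, ha⟩ := hu (Sum.inl B) (by simp)
      simp at ha
  have h2 := congrArg termPrefix h1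
  simp only [hA, List.map_cons, List.map_nil, List.append_assoc, termPrefix_map_inr_append,
    termPrefix_inl_cons, List.cons_append, List.append_nil] at h2
  subst h2
  simp only [hA, List.map_cons, List.map_nil, List.append_assoc, List.append_cancel_left_eq,
    List.cons_append, List.nil_append, List.cons.injEq, Sum.inl.injEq] at h1
  obtain ⟨rfl, rfl⟩ := h1
  exact ⟨hA, rfl⟩

/-- The part of the sentential form that follows the finished blocks. -/
def abRest : Option ℕ → List (Bool ⊕ Bool)
  | none => [Sum.inl true]
  | some i => abCore i ++ [Sum.inl true]

theorem lang_abGrammar_subset_abLang {ρ : AccRho} (hρ : ρ = .cap ∨ ρ = .eq) :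
    (abGrammar ρ).Lang .inf ρ .l ⊆ abLang := by
  rintro u ⟨s, d, hs0, hs, -, hmat, hacc⟩
  replace hacc := (abGrammar_acc hρ _).1 hacc
  let Φ : List ℕ × Option ℕ → ℕ := fun c => 2 * c.1.length + c.2.toList.length
  obtain ⟨f, hf0, hf⟩ := exists_seq (S := List ℕ × Option ℕ)
    (Inv := fun t c => s t = (abWord c.1).map Sum.inr ++ abRest c.2 ∧ ∀ n ∈ c.1, 1 ≤ n)
    (Rel := fun t c c' => c.1 <+: c'.1 ∧ Φ c ≤ Φ c' ∧ (d t = .split → Φ c < Φ c'))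
    (s₀ := ([], none)) ⟨hs0, by simp⟩ (by
      rintro t ⟨ns, o⟩ ⟨h1, h2⟩
      have h3 : (abGrammar ρ).LStep (d t) (s t) (s (t + 1)) := hs t
      simp only at h1 h2
      rw [h1] at h3
      cases o with
      | none =>
        obtain ⟨h4, h5⟩ := h3.eq_of_inl (isCFG_abGrammar ρ)
        cases hd : d t with
        | split =>
          refine ⟨(ns, some 0), ⟨List.prefix_rfl, by simp [Φ], by simp [Φ]⟩, ?_, h2⟩
          rw [h5, hd]
          simp [abRest, abCore]
        | wrap => simp [hd] at h4
        | base => simp [hd] at h4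
      | some i =>
        have h6 : (abWord ns).map Sum.inr ++ abRest (some i) =
            (abWord ns ++ List.replicate i false).map Sum.inr ++ Sum.inl false ::
              ((List.replicate i true).map Sum.inr ++ [Sum.inl true]) := by
          simp [abRest, abCore]
        rw [h6] at h3
        obtain ⟨h4, h5⟩ := h3.eq_of_inl (isCFG_abGrammar ρ)
        cases hd : d t with
        | split => simp [hd] at h4
        | wrap =>
          refine ⟨(ns, some (i + 1)), ⟨List.prefix_rfl, by simp [Φ], by simp⟩, ?_, h2⟩
          rw [h5, hd]
          simp only [abRest, abCore]
          rw [List.replicate_succ', List.replicate_succ]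
          simp
        | base =>
          refine ⟨(ns ++ [i + 1], none), ⟨List.prefix_append _ _, by simp [Φ], by simp⟩,
            ?_, ?_⟩
          · rw [h5, hd, abWord_append, abWord_singleton, abBlock, List.replicate_succ',
              List.replicate_succ]
            simp [abRest]
          · intro n hn
            rcases List.mem_append.1 hn with hn | hn
            · exact h2 n hn
            · simp at hn
              omega)
  have hmono : Monotone fun t => Φ (f t) := monotone_nat_of_le_succ fun t => (hf t).2.2.1
  have hΦ : ∀ n : ℕ, ∃ t, n ≤ Φ (f t) := by
    intro n
    induction n with
    | zero => exact ⟨0, Nat.zero_le _⟩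
    | succ n ih =>
      obtain ⟨t, ht⟩ := ih
      obtain ⟨m, hm, hd⟩ := hacc t
      have h1 := hmono hm
      have h2 := (hf m).2.2.2 hd
      simp only at h1
      exact ⟨m + 1, by omega⟩
  have hlen : ∀ n : ℕ, ∃ t, n ≤ (f t).1.length := by
    intro n
    obtain ⟨t, ht⟩ := hΦ (2 * n + 1)
    refine ⟨t, ?_⟩
    have : (f t).2.toList.length ≤ 1 := by cases (f t).2 <;> simp
    simp only [Φ] at ht
    omega
  obtain ⟨n, hn⟩ := exists_limit_word (fun t => (f t).1) (fun t => (hf t).2.1) hlen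
  refine mem_abLang_iff.2 ⟨n, fun i => ?_, fun i => ?_⟩
  · obtain ⟨t, ht⟩ := hlen (i + 1)
    rw [← hn t i ht]
    exact (hf t).1.2 _ (List.getElem_mem _)
  · obtain ⟨t, ht⟩ := hlen i
    have h1 := hmat t
    rw [(hf t).1.1, termPrefix_map_inr_append] at h1
    exact h1.mono ((abWord_isPrefix ((hn t).map_range ht)).trans (List.prefix_append _ _))

theorem abLang_mem_gLang_l {ρ : AccRho} (hρ : ρ = .cap ∨ ρ = .eq) :
    abLang ∈ GLang Bool OmegaPSG.IsCFG .inf ρ .l :=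
  ⟨abGrammar ρ, isCFG_abGrammar ρ,
    (abLang_subset_lang_abGrammar hρ).antisymm (lang_abGrammar_subset_abLang hρ)⟩

section Words

variable {T : Type*}

/-- The concatenation of a word and an ω-word. -/
def cat (w : List T) (u : ℕ → T) (n : ℕ) : T :=
  if h : n < w.length then w[n] else u (n - w.length)

theorem matchesPrefix_cat (w : List T) (u : ℕ → T) : MatchesPrefix w (cat w u) := by
  intro k hk
  simp [cat, hk]

@[simp] theorem cat_length_add (w : List T) (u : ℕ → T) (i : ℕ) :
    cat w u (w.length + i) = u i := by
  simp [cat]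

theorem cat_eq_of_matchesPrefix {w : List T} {u : ℕ → T} (h : MatchesPrefix w u) :
    cat w (fun i => u (w.length + i)) = u := by
  funext n
  unfold cat
  split_ifs with hn
  · exact h n hn
  · simp only
    rw [Nat.add_sub_cancel' (by omega)]

theorem cat_append (w w' : List T) (u : ℕ → T) : cat (w ++ w') u = cat w (cat w' u) := by
  have h1 := matchesPrefix_append.1 (matchesPrefix_cat (w ++ w') u)
  rw [← cat_eq_of_matchesPrefix h1.1]
  congr 1
  rw [← cat_eq_of_matchesPrefix h1.2]
  congr 1
  funext i
  rw [← Nat.add_assoc, ← List.length_append, cat_length_add]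

end Words

theorem abLang_frequently {u : ℕ → Bool} (hu : u ∈ abLang) (b : Bool) (N : ℕ) :
    ∃ t, N ≤ t ∧ u t = b := by
  obtain ⟨n, hn, h⟩ := hu
  have h1 := le_length_abWord_range hn N
  rw [length_abWord_range] at h1
  have h2 := hn N
  cases b with
  | false => exact ⟨_, by omega, (h N 0 (by omega)).trans (by simp; omega)⟩
  | true => exact ⟨_, by omega, (h N (n N) (by omega)).trans (by simp)⟩

theorem exists_block_position {n : ℕ → ℕ} (hn : ∀ i, 1 ≤ n i) (t : ℕ) :
    ∃ i k, k < 2 * n i ∧ t = (∑ j ∈ Finset.range i, 2 * n j) + k := by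
  induction t with
  | zero => exact ⟨0, 0, by have := hn 0; omega, rfl⟩
  | succ t ih =>
    obtain ⟨i, k, hk, rfl⟩ := ih
    by_cases h : k + 1 < 2 * n i
    · exact ⟨i, k + 1, h, rfl⟩
    · refine ⟨i + 1, 0, by have := hn (i + 1); omega, ?_⟩
      rw [Finset.sum_range_succ]
      omega

/-- In a word of `abLang`, a run of `a`s between two `b`s is as long as the run of `b`s after it. -/
theorem abLang_run_eq {u : ℕ → Bool} (hu : u ∈ abLang) {s m q : ℕ} (hs : u s = true)
    (hm : 0 < m) (h1 : ∀ i < m, u (s + 1 + i) = false) (hq : 0 < q)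
    (h2 : ∀ i < q, u (s + 1 + m + i) = true) (h3 : u (s + 1 + m + q) = false) : m = q := by
  obtain ⟨n, hn, h⟩ := hu
  obtain ⟨i, k, hk, hik⟩ := exists_block_position hn (s + 1)
  have h4 : k = 0 := by
    by_contra hk0
    have h5 := h1 0 hm
    rw [Nat.add_zero, hik, h i k hk] at h5
    have h6 := h i (k - 1) (by omega)
    rw [show (∑ j ∈ Finset.range i, 2 * n j) + (k - 1) = s by omega, hs] at h6
    simp at h5 h6
    omega
  subst h4
  replace hik : s + 1 = ∑ j ∈ Finset.range i, 2 * n j := hik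
  rw [hik] at h1 h2 h3
  have h5 : m = n i := by
    rcases Nat.lt_trichotomy m (n i) with h6 | h6 | h6
    · have h7 := h2 0 hq
      rw [Nat.add_zero, h i m (by omega)] at h7
      simp at h7
      omega
    · exact h6
    · have h7 := h1 (n i) h6
      rw [h i _ (by have := hn i; omega)] at h7
      simp at h7
  subst h5
  rcases Nat.lt_trichotomy (n i) q with h6 | h6 | h6
  · have h7 := h2 (n i) h6
    have h8 := h (i + 1) 0 (by have := hn (i + 1); omega)
    rw [Finset.sum_range_succ, Nat.add_zero, Nat.two_mul (n i), ← Nat.add_assoc, h7] at h8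
    have := hn (i + 1)
    simp at h8
    omega
  · exact h6
  · rw [Nat.add_assoc, h i (n i + q) (by omega)] at h3
    simp at h3

/-- The length of a run of `a`s between two `b`s is determined by what follows. -/
theorem abLang_run_unique {p p' r : List Bool} {v : ℕ → Bool} {m m' : ℕ} (hm : 0 < m)
    (hm' : 0 < m')
    (h : cat (p ++ true :: (List.replicate m false ++ true :: r)) v ∈ abLang)
    (h' : cat (p' ++ true :: (List.replicate m' false ++ true :: r)) v ∈ abLang) : m = m' := by
  classical
  set c := cat (true :: r) v with hc
  have hc0 : c 0 = true := by simp [hc, cat]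
  have hsplit : ∀ (p : List Bool) (m : ℕ),
      cat (p ++ true :: (List.replicate m false ++ true :: r)) v =
        cat (p ++ [true]) (cat (List.replicate m false) c) := by
    intro p m
    rw [hc, ← cat_append, ← cat_append]
    simp
  rw [hsplit] at h h'
  have htail : ∀ (p : List Bool) (m i : ℕ),
      cat (p ++ [true]) (cat (List.replicate m false) c) (p.length + 1 + m + i) = c i := by
    intro p m i
    have h1 := cat_length_add (p ++ [true]) (cat (List.replicate m false) c) (m + i)
    have h2 := cat_length_add (List.replicate m false) c i
    simp only [List.length_append, List.length_cons, List.length_nil, zero_add,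
      List.length_replicate] at h1 h2
    rw [Nat.add_assoc, h1, h2]
  have hex : ∃ q, c q = false := by
    obtain ⟨t, ht, h1⟩ := abLang_frequently h false (p.length + 1 + m)
    obtain ⟨q, rfl⟩ := Nat.exists_eq_add_of_le ht
    exact ⟨q, by rw [← h1, htail]⟩
  have hq := Nat.find_spec hex
  have hmin : ∀ i < Nat.find hex, c i = true := fun i hi => by
    simpa using Nat.find_min hex hi
  have hq0 : 0 < Nat.find hex := by
    by_contra h0
    rw [Nat.eq_zero_of_not_pos h0, hc0] at hq
    simp at hq
  have key : ∀ (p : List Bool) (m : ℕ), 0 < m →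
      cat (p ++ [true]) (cat (List.replicate m false) c) ∈ abLang → m = Nat.find hex := by
    intro p m hm h
    refine abLang_run_eq h (s := p.length) ?_ hm ?_ hq0 ?_ ?_
    · have := matchesPrefix_cat (p ++ [true]) (cat (List.replicate m false) c) p.length (by simp)
      rw [← this]
      simp
    · intro i hi
      have h1 := cat_length_add (p ++ [true]) (cat (List.replicate m false) c) i
      simp only [List.length_append, List.length_cons, List.length_nil, zero_add] at h1
      rw [h1]
      simp [cat, hi]
    · intro i hi
      rw [htail, hmin i hi]
    · rw [htail, hq]
  rw [key p m hm h, key p' m' hm' h']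

theorem append_eq_replicate_append_cons {w₁ w₂ r : List Bool} {m : ℕ}
    (h : w₁ ++ w₂ = List.replicate m false ++ true :: r) :
    (∃ c m', m = c + m' ∧ w₁ = List.replicate c false ∧
      w₂ = List.replicate m' false ++ true :: r) ∨
    ∃ r₁, w₁ = List.replicate m false ++ true :: r₁ ∧ r = r₁ ++ w₂ := by
  rcases List.append_eq_append_iff.1 h with ⟨c, h1, rfl⟩ | ⟨c, rfl, h1⟩
  · obtain ⟨h2, h3, h4⟩ := List.append_eq_replicate_iff.1 h1.symm
    exact Or.inl ⟨w₁.length, c.length, h2.symm, h3, by rw [← h4]⟩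
  · cases c with
    | nil => exact Or.inl ⟨m, 0, rfl, by simp, by simpa using h1.symm⟩
    | cons b c =>
      simp only [List.cons_append, List.cons.injEq] at h1
      obtain ⟨rfl, rfl⟩ := h1
      exact Or.inr ⟨c, rfl, rfl⟩

theorem append_eq_append_run {w₁ w₂ l r : List Bool} {g : ℕ}
    (h : w₁ ++ w₂ = l ++ true :: (List.replicate g false ++ true :: r)) :
    (∃ l', w₂ = l' ++ true :: (List.replicate g false ++ true :: r)) ∨
    (∃ i g', g = i + g' ∧ w₁ = l ++ true :: List.replicate i false ∧
      w₂ = List.replicate g' false ++ true :: r) ∨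
    ∃ r₁, w₁ = l ++ true :: (List.replicate g false ++ true :: r₁) ∧ r = r₁ ++ w₂ := by
  rcases List.append_eq_append_iff.1 h with ⟨c, -, rfl⟩ | ⟨c, rfl, h1⟩
  · exact Or.inl ⟨c, rfl⟩
  · cases c with
    | nil => exact Or.inl ⟨[], by simpa using h1.symm⟩
    | cons b c =>
      simp only [List.cons_append, List.cons.injEq] at h1
      obtain ⟨rfl, h1⟩ := h1
      rcases append_eq_replicate_append_cons h1.symm with ⟨i, g', rfl, rfl, rfl⟩ | ⟨r₁, rfl, rfl⟩
      · exact Or.inr (Or.inl ⟨i, g', rfl, rfl, rfl⟩)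
      · exact Or.inr (Or.inr ⟨r₁, rfl, rfl⟩)

open Classical in
/-- A positive element of a set of natural numbers, or `0` if there is none. -/
noncomputable def pick (A : Set ℕ) : ℕ := if h : ∃ m ∈ A, 0 < m then h.choose else 0

theorem le_pick {A : Set ℕ} (h : ∀ m ∈ A, ∀ m' ∈ A, 0 < m → 0 < m' → m = m') {m : ℕ}
    (hm : m ∈ A) : m ≤ pick A := by
  rcases Nat.eq_zero_or_pos m with rfl | hpos
  · exact Nat.zero_le _
  · have hex : ∃ m ∈ A, 0 < m := ⟨m, hm, hpos⟩
    rw [pick, dif_pos hex]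
    exact (h m hm _ hex.choose_spec.1 hpos hex.choose_spec.2).le

namespace OmegaPSG

variable {G : OmegaPSG Bool} {F : Set G.P}

/-- `y` is derivable from `x` in at most `n` steps with productions from `F`. -/
def DerivesIn (F : Set G.P) (n : ℕ) (x y : List (G.N ⊕ Bool)) : Prop :=
  ∃ ps, (∀ q ∈ ps, q ∈ F) ∧ ps.length ≤ n ∧ G.Derives ps x y

/-- `y` is derivable from `x` with productions from `F`. -/
def DerivesWith (F : Set G.P) (x y : List (G.N ⊕ Bool)) : Prop :=
  ∃ ps, (∀ q ∈ ps, q ∈ F) ∧ G.Derives ps x y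

theorem DerivesIn.derivesWith {n : ℕ} {x y : List (G.N ⊕ Bool)} (h : DerivesIn F n x y) :
    DerivesWith F x y := by
  obtain ⟨ps, h1, -, h2⟩ := h
  exact ⟨ps, h1, h2⟩

theorem DerivesWith.exists_derivesIn {x y : List (G.N ⊕ Bool)} (h : DerivesWith F x y) :
    ∃ n, DerivesIn F n x y := by
  obtain ⟨ps, h1, h2⟩ := h
  exact ⟨_, ps, h1, le_rfl, h2⟩

theorem DerivesWith.refl (x : List (G.N ⊕ Bool)) : DerivesWith F x x :=
  ⟨[], by simp, .nil x⟩

theorem DerivesWith.trans {x y z : List (G.N ⊕ Bool)} (h : DerivesWith F x y)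
    (h' : DerivesWith F y z) : DerivesWith F x z := by
  obtain ⟨ps, h1, h2⟩ := h
  obtain ⟨ps', h1', h2'⟩ := h'
  refine ⟨ps ++ ps', fun q hq => ?_, Der.append h2 h2'⟩
  exact (List.mem_append.1 hq).elim (h1 q) (h1' q)

theorem DerivesWith.append {x y x' y' : List (G.N ⊕ Bool)} (h : DerivesWith F x y)
    (h' : DerivesWith F x' y') : DerivesWith F (x ++ x') (y ++ y') := by
  obtain ⟨ps, h1, h2⟩ := h
  obtain ⟨ps', h1', h2'⟩ := h'
  exact DerivesWith.trans ⟨ps, h1, h2.append_right x'⟩ ⟨ps', h1', h2'.append_left y⟩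

theorem DerivesIn.split_cons (hG : G.IsCFG) {n : ℕ} {s : G.N ⊕ Bool} {α : List (G.N ⊕ Bool)}
    {w : List Bool} (h : DerivesIn F n (s :: α) (w.map Sum.inr)) :
    ∃ w₁ w₂, w₁ ++ w₂ = w ∧ DerivesIn F n [s] (w₁.map Sum.inr) ∧
      DerivesIn F n α (w₂.map Sum.inr) := by
  obtain ⟨ps, h1, h2, h3⟩ := h
  obtain ⟨ps₁, ps₂, z₁, z₂, h4, h5, h6, h7, h8⟩ :=
    Derives.split hG (a := [s]) (b := α) (by simpa using h3)
  obtain ⟨w₁, w₂, rfl, rfl, rfl⟩ := exists_of_append_eq_map_inr h4.symm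
  exact ⟨w₁, w₂, rfl, ⟨ps₁, fun q hq => h1 q ((h7 q).2 (Or.inl hq)), by omega, h5⟩,
    ps₂, fun q hq => h1 q ((h7 q).2 (Or.inr hq)), by omega, h6⟩

theorem DerivesIn.eq_of_inr (hG : G.IsCFG) {n : ℕ} {a : Bool} {w : List Bool}
    (h : DerivesIn F n [Sum.inr a] (w.map Sum.inr)) : w = [a] := by
  obtain ⟨ps, -, -, h3⟩ := h
  exact map_inr_injective (Derives.eq_of_map_inr hG (w := [a]) h3).2

theorem DerivesIn.eq_of_nil (hG : G.IsCFG) {n : ℕ} {w : List Bool}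
    (h : DerivesIn F n [] (w.map Sum.inr)) : w = [] := by
  obtain ⟨ps, -, -, h3⟩ := h
  exact map_inr_injective (Derives.eq_of_map_inr hG (w := []) h3).2

theorem DerivesIn.of_inl (hG : G.IsCFG) {n : ℕ} {X : G.N} {w : List Bool}
    (h : DerivesIn F n [Sum.inl X] (w.map Sum.inr)) :
    ∃ p n', n = n' + 1 ∧ DerivesWith F [Sum.inl X] (G.rhs p) ∧
      DerivesIn F n' (G.rhs p) (w.map Sum.inr) := by
  obtain ⟨ps, h1, h2, h3⟩ := h
  obtain ⟨p, ps', rfl, h4, h5⟩ := Derives.of_singleton hG h3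
  simp only [List.length_cons] at h2
  simp only [List.mem_cons, forall_eq_or_imp] at h1
  refine ⟨p, n - 1, by omega, ⟨[p], by simpa using h1.1, .single (step_of_lhs_eq h4)⟩,
    ps', h1.2, by omega, h5⟩

/-- The form `α` occurs in an accepting derivation whose recurring productions are `F`, and
whatever terminal word is derived from `α` with these productions, inserting it between
`pre` and `suf` yields a word of `abLang` when `v` is appended. -/
structure Context (F : Set G.P) (v : ℕ → Bool) (α : List (G.N ⊕ Bool)) (pre suf : List Bool) :
    Prop where
  occurs : ∃ (ps : List G.P) (w : List Bool) (r : List (G.N ⊕ Bool)),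
    G.Derives ps [Sum.inl G.start] (w.map Sum.inr ++ (α ++ r)) ∧ Recurrent G.Step F r
  mem : ∀ w : List Bool, DerivesWith F α (w.map Sum.inr) → cat (pre ++ w ++ suf) v ∈ abLang

variable {v : ℕ → Bool} {α β : List (G.N ⊕ Bool)} {pre suf : List Bool}

theorem Context.left (h : Context F v (α ++ β) pre suf) {w : List Bool}
    (hw : DerivesWith F β (w.map Sum.inr)) : Context F v α pre (w ++ suf) := by
  obtain ⟨ps, w', r, h1, h2⟩ := h.occurs
  refine ⟨⟨ps, w', β ++ r, by simpa using h1, ?_⟩, fun w₁ h₁ => ?_⟩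
  · have := Recurrent.append (Recurrent.empty β) h2
    rwa [Set.empty_union] at this
  · have := h.mem (w₁ ++ w) (by simpa using h₁.append hw)
    simpa using this

theorem Context.right (h : Context F v (α ++ β) pre suf) {w : List Bool}
    (hw : DerivesWith F α (w.map Sum.inr)) : Context F v β (pre ++ w) suf := by
  obtain ⟨ps, w', r, h1, h2⟩ := h.occurs
  have ⟨ps', _, h3⟩ := hw
  refine ⟨⟨ps ++ ps', w' ++ w, r, ?_, h2⟩, fun w₁ h₁ => ?_⟩
  · have h4 := (h3.append_right (β ++ r)).append_left (w'.map Sum.inr)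
    rw [List.append_assoc] at h1
    have := Der.append h1 h4
    simpa using this
  · have := h.mem (w ++ w₁) (by simpa using hw.append h₁)
    simpa using this

theorem Context.trans (h : Context F v α pre suf) (hβ : DerivesWith F α β) :
    Context F v β pre suf := by
  refine ⟨?_, fun w hw => h.mem w (hβ.trans hw)⟩
  obtain ⟨ps, w, r, h1, h2⟩ := h.occurs
  obtain ⟨ps', -, h3⟩ := hβ
  exact ⟨ps ++ ps', w, r, Der.append h1 ((h3.append_right r).append_left _), h2⟩

theorem Context.not_pump {ρ : AccRho} (hL : G.Lang .inf ρ .nl = abLang)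
    (hF : ∃ F' ∈ G.acc, rhoRel ρ F F') {X : G.N} {ν : List (G.N ⊕ Bool)} {c : ℕ}
    (h : Context F v [Sum.inl X] pre suf) (hc : 0 < c) :
    ¬ DerivesWith F [Sum.inl X] ((List.replicate c false).map Sum.inr ++ Sum.inl X :: ν) := by
  rintro ⟨ps, hps, hX⟩
  obtain ⟨ps₀, w, r₀, h1, h2⟩ := h.occurs
  obtain ⟨f, hf0, hf⟩ := exists_seq (Inv := fun _ r => Recurrent G.Step F r)
    (Rel := fun _ r r' => ∃ qs, {q | q ∈ qs} = F ∧ G.Derives qs (ν ++ r) r') h2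
    (fun n r hr => by
      have h3 := Recurrent.append (Recurrent.empty ν) hr
      rw [Set.empty_union] at h3
      obtain ⟨qs, y, h4, h5, h6⟩ := h3.next
      exact ⟨y, ⟨qs, h4, h5⟩, h6⟩)
  choose hrec qs hqs hder using hf
  have hword : cat w (fun _ => false) ∈ abLang := by
    rw [← hL]
    let x : ℕ → List (G.N ⊕ Bool) := fun
      | 0 => [Sum.inl G.start]
      | n + 1 => (w ++ List.replicate (n * c) false).map Sum.inr ++ Sum.inl X :: f n
    let ds : ℕ → List G.P := fun
      | 0 => ps₀
      | n + 1 => ps ++ qs n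
    refine mem_lang_of_blocks (x := x) (ps := ds) rfl ?_ ?_ ?_ ?_
    · rintro (_ | n)
      · simpa [x, ds, hf0, StepOf] using h1
      · have h3 := (hX.append_right (f n)).append_left
          ((w ++ List.replicate (n * c) false).map Sum.inr)
        have h4 := (hder n).append_left
          ((w ++ List.replicate ((n + 1) * c) false).map Sum.inr ++ [Sum.inl X])
        have e : (w ++ List.replicate (n * c) false).map Sum.inr ++
            ((List.replicate c false).map Sum.inr ++ Sum.inl X :: ν ++ f n) =
            (w ++ List.replicate ((n + 1) * c) false).map Sum.inr ++ [Sum.inl X] ++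
              (ν ++ f n) := by
          rw [Nat.succ_mul, List.replicate_add]
          simp only [List.map_append, List.append_assoc, List.cons_append, List.nil_append]
        rw [e] at h3
        have h5 := Der.append h3 h4
        simpa [x, ds, StepOf] using h5
    · intro n
      refine ⟨n + 1, ?_⟩
      simp only [x, termPrefix_map_inr_append, termPrefix_inl_cons, List.append_nil,
        List.length_append, List.length_replicate]
      nlinarith
    · rintro (_ | n)
      · simpa [x] using MatchesPrefix.nil _
      · simp only [x, termPrefix_map_inr_append, termPrefix_inl_cons, List.append_nil]
        refine matchesPrefix_append.2 ⟨matchesPrefix_cat _ _, fun k hk => ?_⟩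
        simp
    · obtain ⟨F', hF', h3⟩ := hF
      refine ⟨F', hF', ?_⟩
      convert h3 using 1
      ext q
      constructor
      · intro hq
        obtain ⟨m, hm, h4⟩ := hq 1
        obtain ⟨m, rfl⟩ := Nat.exists_eq_add_of_le' hm
        rcases List.mem_append.1 h4 with h5 | h5
        · exact hps q h5
        · exact (hqs m).subset h5
      · intro hq n
        exact ⟨n + 1, by omega, List.mem_append.2 (Or.inr ((hqs n).superset hq))⟩
  obtain ⟨t, ht, h3⟩ := abLang_frequently hword true w.length
  obtain ⟨i, rfl⟩ := Nat.exists_eq_add_of_le ht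
  simp at h3

/-- The length of a nonempty word `aᵐ` derivable from the symbol `s`. -/
noncomputable def runVal (F : Set G.P) (s : G.N ⊕ Bool) : ℕ :=
  pick {m | DerivesWith F [s] ((List.replicate m false).map Sum.inr)}

/-- An upper bound for the lengths of the words `aᵐ` that `α` contributes to an inner run. -/
noncomputable def runSum (F : Set G.P) (α : List (G.N ⊕ Bool)) : ℕ := (α.map (runVal F)).sum

/-- The length of the run of `a`s at the end of a terminal word derivable from `s`. -/
noncomputable def tailVal (F : Set G.P) (s : G.N ⊕ Bool) : ℕ :=
  pick {m | ∃ l : List Bool,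
    DerivesWith F [s] ((l ++ true :: List.replicate m false).map Sum.inr)}

theorem Context.le_runVal {s : G.N ⊕ Bool} {p r : List Bool} {k j c : ℕ}
    (h : Context F v [s] (p ++ true :: List.replicate k false)
      (List.replicate j false ++ true :: r))
    (hc : DerivesWith F [s] ((List.replicate c false).map Sum.inr)) : c ≤ runVal F s := by
  have key : ∀ m, DerivesWith F [s] ((List.replicate m false).map Sum.inr) →
      cat (p ++ true :: (List.replicate (k + m + j) false ++ true :: r)) v ∈ abLang := by
    intro m hm
    have := h.mem _ hm
    rw [List.replicate_add, List.replicate_add]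
    simpa only [List.append_assoc, List.cons_append] using this
  refine le_pick (fun m hm m' hm' h1 h2 => ?_) hc
  have := abLang_run_unique (by omega) (by omega) (key m hm) (key m' hm')
  omega

theorem Context.le_tailVal {s : G.N ⊕ Bool} {l r : List Bool} {j c : ℕ}
    (h : Context F v [s] pre (List.replicate j false ++ true :: r))
    (hc : DerivesWith F [s] ((l ++ true :: List.replicate c false).map Sum.inr)) :
    c ≤ tailVal F s := by
  have key : ∀ l m, DerivesWith F [s] ((l ++ true :: List.replicate m false).map Sum.inr) →
      cat ((pre ++ l) ++ true :: (List.replicate (m + j) false ++ true :: r)) v ∈ abLang := by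
    intro l m hm
    have := h.mem _ hm
    rw [List.replicate_add]
    simpa only [List.append_assoc, List.cons_append] using this
  refine le_pick (fun m hm m' hm' h1 h2 => ?_) ⟨l, hc⟩
  obtain ⟨l₁, hm⟩ := hm
  obtain ⟨l₂, hm'⟩ := hm'
  have := abLang_run_unique (by omega) (by omega) (key l₁ m hm) (key l₂ m' hm')
  omega

/-- The leading run of `a`s derived from `α` is short, except for the part contributed by the
symbol that derives the `b` ending this run. -/
theorem Context.leading_run (hG : G.IsCFG) {n : ℕ} (α : List (G.N ⊕ Bool)) {p r : List Bool}
    {k m : ℕ} (h : Context F v α (p ++ true :: List.replicate k false) suf)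
    (hα : DerivesIn F n α ((List.replicate m false ++ true :: r).map Sum.inr)) :
    m ≤ runSum F α ∨ ∃ α₁ X α₂ c m' k' r' suf', α = α₁ ++ Sum.inl X :: α₂ ∧ m = c + m' ∧
      DerivesWith F α₁ ((List.replicate c false).map Sum.inr) ∧ c ≤ runSum F α ∧
      DerivesIn F n [Sum.inl X] ((List.replicate m' false ++ true :: r').map Sum.inr) ∧
      Context F v [Sum.inl X] (p ++ true :: List.replicate k' false) suf' := by
  induction α generalizing k m r with
  | nil => simpa using hα.eq_of_nil hG
  | cons s α ih =>
    obtain ⟨w₁, w₂, h1, h2, h3⟩ := hα.split_cons hG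
    have hleft := Context.left (α := [s]) h h3.derivesWith
    have hright := Context.right (α := [s]) h h2.derivesWith
    have hsum : runSum F (s :: α) = runVal F s + runSum F α := by simp [runSum]
    rcases append_eq_replicate_append_cons h1 with ⟨c, m', rfl, rfl, rfl⟩ | ⟨r₁, rfl, rfl⟩
    · have hc : c ≤ runVal F s := by
        rw [List.append_assoc, List.cons_append] at hleft
        exact hleft.le_runVal h2.derivesWith
      rw [List.append_assoc, List.cons_append, ← List.replicate_add] at hright
      rcases ih hright h3 with h4 | ⟨α₁, X, α₂, c', m'', k', r', suf', rfl, rfl, h5, h6, h7, h8⟩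
      · exact Or.inl (by omega)
      · refine Or.inr ⟨s :: α₁, X, α₂, c + c', m'', k', r', suf', rfl, by omega, ?_, by omega,
          h7, h8⟩
        have := h2.derivesWith.append h5
        rw [List.replicate_add, List.map_append]
        simpa only [List.singleton_append] using this
    · cases s with
      | inl X =>
        exact Or.inr ⟨[], X, α, 0, m, k, r₁, _, rfl, by omega, DerivesWith.refl _,
          Nat.zero_le _, h2, hleft⟩
      | inr a =>
        have h4 := congrArg List.length (h2.eq_of_inr hG)
        simp at h4
        exact Or.inl (by omega)

/-- The nonterminals that occur behind a nonempty word `aᶜ` in a form derived from `X`. -/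
def behindRun (F : Set G.P) (X : G.N) : Set G.N :=
  {B | ∃ c, 0 < c ∧ ∃ ν : List (G.N ⊕ Bool),
    DerivesWith F [Sum.inl X] ((List.replicate c false).map Sum.inr ++ Sum.inl B :: ν)}

theorem behindRun_subset {X Y : G.N} {c : ℕ} {ν : List (G.N ⊕ Bool)}
    (h : DerivesWith F [Sum.inl X] ((List.replicate c false).map Sum.inr ++ Sum.inl Y :: ν)) :
    behindRun F Y ⊆ behindRun F X := by
  rintro B ⟨c', hc', ν', h'⟩
  refine ⟨c + c', by omega, ν' ++ ν, h.trans ?_⟩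
  have := (DerivesWith.refl ((List.replicate c false).map Sum.inr)).append
    (h'.append (DerivesWith.refl ν))
  rw [List.replicate_add, List.map_append]
  simpa only [List.append_assoc, List.cons_append, List.nil_append] using this

variable {ρ : AccRho} {M B : ℕ}

theorem Context.leading_run_inl (hG : G.IsCFG) (hL : G.Lang .inf ρ .nl = abLang)
    (hF : ∃ F' ∈ G.acc, rhoRel ρ F F') (hM : ∀ p, runSum F (G.rhs p) ≤ M) {n m k : ℕ} {X : G.N}
    {p r : List Bool}
    (h : Context F v [Sum.inl X] (p ++ true :: List.replicate k false) suf)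
    (hX : DerivesIn F n [Sum.inl X] ((List.replicate m false ++ true :: r).map Sum.inr)) :
    m ≤ M * (1 + (behindRun F X).ncard) := by
  induction n generalizing m k X r suf with
  | zero =>
    obtain ⟨_, _, h1, -⟩ := hX.of_inl hG
    omega
  | succ n ih =>
    obtain ⟨q, n', h1, h2, h3⟩ := hX.of_inl hG
    obtain rfl : n = n' := by omega
    have hq := hM q
    rcases (h.trans h2).leading_run hG _ h3 with
      h4 | ⟨α₁, Y, α₂, c, m', k', r', suf', h4, rfl, h5, h6, h7, h8⟩
    · nlinarith [Nat.zero_le (M * (behindRun F X).ncard)]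
    · have h9 := ih h8 h7
      have h10 : DerivesWith F [Sum.inl X]
          ((List.replicate c false).map Sum.inr ++ Sum.inl Y :: α₂) := by
        rw [h4] at h2
        exact h2.trans (h5.append (DerivesWith.refl _))
      have h11 := behindRun_subset h10
      rcases Nat.eq_zero_or_pos c with rfl | hc
      · have := Set.ncard_le_ncard h11 (Set.toFinite _)
        nlinarith
      · have h12 : behindRun F Y ⊂ behindRun F X := by
          refine (Set.ssubset_iff_of_subset h11).2 ⟨Y, ⟨c, hc, α₂, h10⟩, ?_⟩
          rintro ⟨c', hc', ν, h13⟩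
          exact h8.not_pump hL hF hc' h13
        have := Set.ncard_lt_ncard h12 (Set.toFinite _)
        nlinarith

theorem Context.leading_run_le (hG : G.IsCFG) (hL : G.Lang .inf ρ .nl = abLang)
    (hF : ∃ F' ∈ G.acc, rhoRel ρ F F') (hM : ∀ p, runSum F (G.rhs p) ≤ M)
    (hα : runSum F α ≤ M) {m k : ℕ} {p r : List Bool}
    (h : Context F v α (p ++ true :: List.replicate k false) suf)
    (hm : DerivesWith F α ((List.replicate m false ++ true :: r).map Sum.inr)) :
    m ≤ M + M * (1 + Nat.card G.N) := by
  obtain ⟨n, hn⟩ := hm.exists_derivesIn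
  rcases h.leading_run hG _ hn with
    h4 | ⟨α₁, Y, α₂, c, m', k', r', suf', h4, rfl, h5, h6, h7, h8⟩
  · omega
  · have h9 := h8.leading_run_inl hG hL hF hM h7
    have h10 := Set.ncard_le_card (behindRun F Y)
    nlinarith

/-- Every run of `a`s between two `b`s in a terminal word derived from `α` is short. -/
theorem Context.inner_run_le (hG : G.IsCFG) (hL : G.Lang .inf ρ .nl = abLang)
    (hF : ∃ F' ∈ G.acc, rhoRel ρ F F') (hM : ∀ p, runSum F (G.rhs p) ≤ M)
    (hB : ∀ X : G.N, tailVal F (Sum.inl X) ≤ B) {n g : ℕ} {l r : List Bool}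
    (hα : runSum F α ≤ M) (h : Context F v α pre suf)
    (hg : DerivesIn F n α ((l ++ true :: (List.replicate g false ++ true :: r)).map Sum.inr)) :
    g ≤ B + (M + M * (1 + Nat.card G.N)) := by
  induction n using Nat.strong_induction_on generalizing α pre suf l r with
  | h n ihn =>
  induction α generalizing pre l r with
  | nil => simpa using hg.eq_of_nil hG
  | cons s α ih =>
    obtain ⟨w₁, w₂, h1, h2, h3⟩ := hg.split_cons hG
    have hleft := Context.left (α := [s]) h h3.derivesWith
    have hright := Context.right (α := [s]) h h2.derivesWith
    have hsum : runSum F (s :: α) = runVal F s + runSum F α := by simp [runSum]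
    rcases append_eq_append_run h1 with ⟨l', rfl⟩ | ⟨i, g', rfl, rfl, rfl⟩ | ⟨r₁, rfl, rfl⟩
    · exact ih (by omega) hright h3
    · have hg' : g' ≤ M + M * (1 + Nat.card G.N) := by
        rw [← List.append_assoc] at hright
        exact hright.leading_run_le hG hL hF hM (by omega) h3.derivesWith
      have hi : i ≤ B := by
        cases s with
        | inl X =>
          rw [List.append_assoc, List.cons_append] at hleft
          exact (hleft.le_tailVal h2.derivesWith).trans (hB X)
        | inr a =>
          have h4 := congrArg List.length (h2.eq_of_inr hG)
          simp at h4
          omega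
      omega
    · cases s with
      | inl X =>
        obtain ⟨q, n', h4, h5, h6⟩ := h2.of_inl hG
        exact ihn n' (by omega) (hM q) (hleft.trans h5) h6
      | inr a =>
        have h4 := congrArg List.length (h2.eq_of_inr hG)
        simp at h4
        omega

end OmegaPSG

theorem MatchesPrefix.exists_eq_append {T : Type*} {x y : List T} {u : ℕ → T}
    (hx : MatchesPrefix x u) (hy : MatchesPrefix y u) (h : x.length ≤ y.length) :
    ∃ r, y = x ++ r := by
  refine ⟨y.drop x.length, ?_⟩
  rw [← List.take_append_drop x.length y]
  congr 1
  · refine List.ext_getElem (by simpa using h) fun k h1 h2 => ?_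
    have h3 := hx k h2
    have h4 := hy k (by omega)
    simp only [List.get_eq_getElem] at h3 h4
    rw [List.getElem_take, h3, h4]
  · simp

namespace OmegaPSG

variable {G : OmegaPSG Bool} {l : ℕ → Level G} {u : ℕ → Bool} {ρ : AccRho}

theorem length_spineWord_mono (l : ℕ → Level G) {j k : ℕ} (h : j ≤ k) :
    (spineWord l j).length ≤ (spineWord l k).length := by
  obtain ⟨k, rfl⟩ := Nat.exists_eq_add_of_le h
  simp [spineWord_add]

/-- `l` is a path of `G` from the start symbol that generates `u` and is accepting. -/
structure IsAcceptingSpine (ρ : AccRho) (u : ℕ → Bool) (l : ℕ → Level G) : Prop where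
  isSpine : IsSpine l
  start : (l 0).Y = G.start
  grow : ∀ n, ∃ k, n ≤ (spineWord l k).length
  spells : ∀ k, MatchesPrefix (spineWord l k) u
  accepts : ∃ F ∈ G.acc, rhoRel ρ (spineInf l) F

theorem IsAcceptingSpine.cat_mem (h : IsAcceptingSpine ρ u l) {j : ℕ} {ps : List G.P}
    {w : List Bool} {r : List (G.N ⊕ Bool)}
    (hd : G.Derives ps [Sum.inl G.start] (w.map Sum.inr ++ Sum.inl (l j).Y :: r))
    (hr : Recurrent G.Step (⋃ i, ⋃ _ : i < j, (l i).R) r) :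
    cat w (fun i => u ((spineWord l j).length + i)) ∈ G.Lang .inf ρ .nl := by
  refine mem_lang_of_isSpine (h.isSpine.shift j) hd hr (fun n => ?_) (fun k => ?_) ?_
  · obtain ⟨k, hk⟩ := h.grow (n + (spineWord l j).length)
    refine ⟨k, ?_⟩
    have h1 := length_spineWord_mono l (Nat.le_add_left k j)
    rw [spineWord_add, List.length_append] at h1
    omega
  · refine matchesPrefix_append.2 ⟨matchesPrefix_cat _ _, ?_⟩
    simp only [cat_length_add]
    have h1 := h.spells (j + k)
    rw [spineWord_add] at h1
    exact (matchesPrefix_append.1 h1).2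
  · rw [spineInf_shift_union]
    exact h.accepts

theorem IsAcceptingSpine.context (h : IsAcceptingSpine ρ u l) (hL : G.Lang .inf ρ .nl = abLang)
    (j : ℕ) :
    Context (spineInf l) (fun i => u ((spineWord l (j + 1)).length + i)) (l j).α
      (spineWord l j) [] := by
  obtain ⟨ps, r, hd, hr⟩ := h.isSpine.exists_derives j
  rw [h.start] at hd
  have hj := h.isSpine j
  have hr' : Recurrent G.Step (⋃ i, ⋃ _ : i < j + 1, (l i).R) ((l j).δ' ++ r) := by
    have := Recurrent.append hj.recurrent hr
    rw [Set.union_comm] at this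
    rwa [Set.biUnion_lt_succ]
  have hd' : ∃ ps', G.Derives ps' [Sum.inl G.start] ((spineWord l j).map Sum.inr ++
      ((l j).α ++ Sum.inl (l (j + 1)).Y :: ((l j).δ' ++ r))) := by
    have h1 := Der.single (step_of_lhs_eq hj.lhs)
    rw [hj.rhs] at h1
    have h2 := hj.tail.append_left ((l j).α ++ [Sum.inl (l (j + 1)).Y])
    simp only [List.append_assoc, List.cons_append, List.nil_append] at h2
    have h3 := (Derives.append_right (Der.append h1 h2) r).append_left ((spineWord l j).map Sum.inr)
    simp only [List.append_assoc, List.cons_append, List.nil_append] at h3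
    exact ⟨_, Der.append hd h3⟩
  obtain ⟨ps', hd'⟩ := hd'
  refine ⟨?_, fun w hw => ?_⟩
  · obtain ⟨vs, y, h1, h2⟩ := (h.isSpine.shift (j + 1)).exists_recurrent hr'
    rw [spineInf_shift_union] at h2
    exact ⟨ps' ++ vs, spineWord l j, y,
      Der.append hd' ((h1.append_left (l j).α).append_left _), h2⟩
  · obtain ⟨qs, -, hw⟩ := hw
    have h1 := (hw.append_right (Sum.inl (l (j + 1)).Y :: ((l j).δ' ++ r))).append_left
      ((spineWord l j).map Sum.inr)
    have h2 := Der.append hd' h1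
    rw [← List.append_assoc, ← List.map_append] at h2
    rw [List.append_nil, ← hL]
    exact h.cat_mem h2 hr'

/-- The length of the run of `a`s at the end of a terminal word that is derivable in front of
the nonterminal `Y`. -/
noncomputable def frontVal (G : OmegaPSG Bool) (Y : G.N) (Q : Set G.P) : ℕ :=
  pick {m | ∃ (ps : List G.P) (w : List Bool) (r : List (G.N ⊕ Bool)),
    G.Derives ps [Sum.inl G.start]
      ((w ++ true :: List.replicate m false).map Sum.inr ++ Sum.inl Y :: r) ∧
    Recurrent G.Step Q r}

theorem IsAcceptingSpine.le_frontVal (h : IsAcceptingSpine ρ u l)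
    (hL : G.Lang .inf ρ .nl = abLang) {j i g : ℕ} {p r : List Bool}
    (hj : spineWord l j = p ++ true :: List.replicate i false)
    (hw : (l j).w = List.replicate g false ++ true :: r) :
    i ≤ frontVal G (l j).Y (⋃ i, ⋃ _ : i < j, (l i).R) := by
  have hu : (fun i => u ((spineWord l j).length + i)) =
      cat (l j).w (fun i => u ((spineWord l (j + 1)).length + i)) := by
    have h1 := h.spells (j + 1)
    rw [spineWord_succ] at h1
    rw [← cat_eq_of_matchesPrefix (matchesPrefix_append.1 h1).2, spineWord_succ]
    simp only [List.length_append, Nat.add_assoc]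
  refine le_pick (fun m hm m' hm' h1 h2 => ?_) ?_
  · have key : ∀ (ps : List G.P) (m : ℕ) (w : List Bool) (s : List (G.N ⊕ Bool)),
        G.Derives ps [Sum.inl G.start]
          ((w ++ true :: List.replicate m false).map Sum.inr ++ Sum.inl (l j).Y :: s) →
        Recurrent G.Step (⋃ i, ⋃ _ : i < j, (l i).R) s →
        cat (w ++ true :: (List.replicate (m + g) false ++ true :: r))
          (fun i => u ((spineWord l (j + 1)).length + i)) ∈ abLang := by
      intro ps m w s h3 h4
      have h5 := h.cat_mem h3 h4
      rw [hu, ← cat_append, hw, hL] at h5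
      rw [List.replicate_add]
      simpa only [List.append_assoc, List.cons_append] using h5
    obtain ⟨ps, w, s, h3, h4⟩ := hm
    obtain ⟨ps', w', s', h3', h4'⟩ := hm'
    have := abLang_run_unique (by omega) (by omega) (key ps m w s h3 h4)
      (key ps' m' w' s' h3' h4')
    omega
  · obtain ⟨ps, s, hd, hs⟩ := h.isSpine.exists_derives j
    rw [h.start, hj] at hd
    exact ⟨ps, p, s, hd, hs⟩

theorem IsAcceptingSpine.exists_bound (hG : G.IsCFG) (h : IsAcceptingSpine ρ u l)
    (hL : G.Lang .inf ρ .nl = abLang) :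
    ∃ C K, ∀ j p g r, K ≤ j → (spineWord l j).length ≤ p.length + 1 + g →
      spineWord l (j + 1) = p ++ true :: (List.replicate g false ++ true :: r) → g ≤ C := by
  obtain ⟨K, hK⟩ := exists_forall_label_subset_spineInf l
  obtain ⟨M, hM⟩ := Finite.exists_le fun q => runSum (spineInf l) (G.rhs q)
  obtain ⟨B, hB⟩ := Finite.exists_le fun X : G.N => tailVal (spineInf l) (Sum.inl X)
  obtain ⟨D, hD⟩ := Finite.exists_le fun YQ : G.N × Set G.P => frontVal G YQ.1 YQ.2
  refine ⟨B + D + (M + M * (1 + Nat.card G.N)), K, fun j p g r hj hlen hp => ?_⟩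
  have hctx := h.context hL j
  have hα : runSum (spineInf l) (l j).α ≤ M := by
    have h1 := hM (l j).p
    rw [(h.isSpine j).rhs] at h1
    simp only [runSum, List.map_append, List.sum_append] at h1 ⊢
    omega
  have hw : DerivesWith (spineInf l) (l j).α ((l j).w.map Sum.inr) :=
    ⟨(l j).ps, fun q hq => hK j hj (Or.inr (Or.inl hq)), (h.isSpine j).der⟩
  rw [spineWord_succ] at hp
  rcases append_eq_append_run hp with ⟨l', h1⟩ | ⟨i, g', rfl, h1, h2⟩ | ⟨r₁, h1, rfl⟩
  · rw [h1] at hw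
    obtain ⟨n, hn⟩ := hw.exists_derivesIn
    have := hctx.inner_run_le hG hL h.accepts hM hB hα hn
    omega
  · have h3 := (h.le_frontVal hL h1 h2).trans (hD (_, _))
    rw [h2] at hw
    rw [h1] at hctx
    have h4 := hctx.leading_run_le hG hL h.accepts hM hα hw
    omega
  · have := congrArg List.length h1
    simp at this
    omega

end OmegaPSG

theorem abLang_notMem_gLang_nl (ρ : AccRho) :
    abLang ∉ GLang Bool OmegaPSG.IsCFG .inf ρ .nl := by
  rintro ⟨G, hG, hL⟩
  have hn : ∀ i, 1 ≤ i + 1 := fun i => by omega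
  obtain ⟨u, hu⟩ := exists_matchesPrefix_abWord hn
  have hmem : u ∈ abLang := mem_abLang_iff.2 ⟨_, hn, hu⟩
  rw [hL] at hmem
  obtain ⟨l, h1, h2, h3, h4, h5⟩ := OmegaPSG.exists_isSpine_of_mem_lang hG hmem
  have hl : OmegaPSG.IsAcceptingSpine ρ u l := ⟨h1, h2, h3, h4, h5⟩
  obtain ⟨C, K, hC⟩ := hl.exists_bound hG hL.symm
  obtain ⟨i, hi⟩ : ∃ i, i = C + (OmegaPSG.spineWord l K).length := ⟨_, rfl⟩
  obtain ⟨p, hp⟩ : ∃ p, abWord ((List.range (i + 1)).map (· + 1)) = p ++ [true] := by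
    rw [abWord_range_succ, abBlock, List.replicate_succ' (a := true), ← List.append_assoc,
      ← List.append_assoc]
    exact ⟨_, rfl⟩
  have hlen := le_length_abWord_range hn (i + 1)
  have hpre := hu (i + 2)
  rw [abWord_range_succ, hp, abBlock, List.replicate_succ (a := true)] at hpre
  rw [hp] at hlen
  simp only [List.length_append, List.length_singleton] at hlen
  have hpre' : MatchesPrefix (p ++ true :: (List.replicate (i + 1 + 1) false ++ [true])) u := by
    have := (matchesPrefix_append (l := p ++ true :: (List.replicate (i + 1 + 1) false ++ [true]))
      (l' := List.replicate (i + 1) true) (u := u)).1 (by simpa using hpre)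
    exact this.1
  have hex : ∃ k, p.length + 1 + (i + 1 + 1) < (OmegaPSG.spineWord l k).length := by
    obtain ⟨k, hk⟩ := h3 (p.length + 1 + (i + 1 + 1) + 1)
    exact ⟨k, hk⟩
  classical
  obtain ⟨j, hj⟩ : ∃ j, Nat.find hex = j + 1 := by
    refine Nat.exists_eq_succ_of_ne_zero fun h0 => ?_
    have := Nat.find_spec hex
    rw [h0] at this
    simp at this
  have hj1 := Nat.find_spec hex
  have hj2 := Nat.find_min hex (m := j) (by omega)
  rw [hj] at hj1
  have hKj : K ≤ j := by
    by_contra hcon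
    have := OmegaPSG.length_spineWord_mono l (show j + 1 ≤ K by omega)
    omega
  obtain ⟨r, hr⟩ := hpre'.exists_eq_append (h4 (j + 1)) (by simp; omega)
  have := hC j p (i + 1 + 1) r hKj (by omega) (by simpa using hr)
  omega

end OmegaFormal

open OmegaFormal

/-- Theorem: for (σ,ρ) ∈ {(inf,⊓), (inf,=)},
𝓛_{σ,ρ,nl}(ω-CFG) ⊊ 𝓛_{σ,ρ,l}(ω-CFG); in particular
L = {aⁿbⁿ | n ≥ 1}^ω (over the alphabet {a,b} = Bool) belongs to
𝓛_{σ,ρ,l}(ω-CFG) but not to 𝓛_{σ,ρ,nl}(ω-CFG). -/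
theorem cfg_nl_ssubset_cfg_l (σ : AccSigma) (ρ : AccRho)
    (h : (σ, ρ) = (AccSigma.inf, AccRho.cap) ∨ (σ, ρ) = (AccSigma.inf, AccRho.eq)) :
    GLang Bool OmegaPSG.IsCFG σ ρ DerivMode.nl ⊂ GLang Bool OmegaPSG.IsCFG σ ρ DerivMode.l ∧
    abLang ∈ GLang Bool OmegaPSG.IsCFG σ ρ DerivMode.l ∧
    abLang ∉ GLang Bool OmegaPSG.IsCFG σ ρ DerivMode.nl := by
  simp only [Prod.mk.injEq, ← and_or_left] at h
  obtain ⟨rfl, hρ⟩ := h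
  have hl := abLang_mem_gLang_l hρ
  have hnl := abLang_notMem_gLang_nl ρ
  exact ⟨(Set.ssubset_iff_of_subset (gLang_nl_subset_gLang_l Bool hρ)).2 ⟨_, hl, hnl⟩, hl, hnl⟩
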